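/- arXiv:0904.4332 — 2 statements merged into one kernel-verified Lean document; each statement's English description precedes it below -/
import Mathlib

section
/- Let Ω ⊊ S² be a proper subdomain of the round sphere and define the first buckling eigenvalue β₁(Ω) = inf { ∫_Ω (Δ̂u)² dω / ∫_Ω |Du|² dω : u ∈ W₀^{2,2}(Ω), u non-constant }. Then β₁(Ω) ≥ 2. -/
/- STATEMENT 7: for a proper subdomain Ω ⊊ S², the first buckling eigenvalue
β₁(Ω) = inf { ∫(Δ̂u)²/∫|Du|² : u ∈ W₀^{2,2}(Ω), u non-constant } satisfies β₁(Ω) ≥ 2. -/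
noncomputable section
open MeasureTheory Real
open scoped RealInnerProductSpace

abbrev E3 := EuclideanSpace ℝ (Fin 3)

/-- the unit sphere S² ⊂ ℝ³ -/
def S2 : Set E3 := Metric.sphere 0 1

/-- the area measure dω on S² (2-dimensional Hausdorff measure) -/
def muS : Measure E3 := MeasureTheory.Measure.hausdorffMeasure 2

/-- degree-zero homogeneous extension of a function on S² -/
def hom0 (f : E3 → ℝ) : E3 → ℝ := fun y => f ((1/‖y‖) • y)

/-- the gradient D on S² (gradient of the homogeneous extension is tangential) -/
def sGrad (f : E3 → ℝ) : E3 → E3 := fun x => gradient (hom0 f) x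

/-- Euclidean Laplacian on ℝ³ -/
def lap3 (v : E3 → ℝ) (x : E3) : ℝ :=
  ∑ i : Fin 3, fderiv ℝ (fun y => fderiv ℝ v y (EuclideanSpace.single i 1)) x
    (EuclideanSpace.single i 1)

/-- the Laplace–Beltrami operator Δ̂ on S² -/
def sLap (f : E3 → ℝ) : E3 → ℝ := fun x => lap3 (hom0 f) x

/-- orthogonal projection onto the tangent plane T_x S² -/
def tproj (x w : E3) : E3 := w - ⟪w, x⟫ • x

/-- the covariant Hessian D²f of f on S², as an endomorphism of T_x S² -/
def sHess (f : E3 → ℝ) (x v : E3) : E3 := tproj x (fderiv ℝ (sGrad f) x v)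

/-- smoothness of a function on (a neighborhood in) S² -/
def smoothS2 (f : E3 → ℝ) : Prop := ContDiffOn ℝ (⊤ : ℕ∞) (hom0 f) {y | y ≠ 0}

/-- Lorentz-Minkowski inner product on ℝ⁴₁ = ℝ³ × ℝ, signature (+,+,+,−) -/
def mink (v w : E3 × ℝ) : ℝ := ⟪v.1, w.1⟫ - v.2 * w.2

/-- the (marginally trapped) spherical graph Y_f = (Df − ½(Δ̂f)ν, −½(Δ̂f + 2f)) -/
def Ysph (f : E3 → ℝ) : E3 → E3 × ℝ :=
  fun x => (sGrad f x - ((1/2) * sLap f x) • x, -(1/2) * (sLap f x + 2 * f x))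

/-- a smooth representative of W₀^{2,2}(Ω): smooth on S², vanishing to first order
outside Ω (extension by zero of an element of the closure of C_c^∞(Ω)), and
non-constant (equivalently, not identically zero) -/
def admissibleW0 (Ω : Set E3) (u : E3 → ℝ) : Prop :=
  smoothS2 u ∧ (∀ x ∈ S2, x ∉ Ω → u x = 0 ∧ sGrad u x = 0) ∧ (∃ x ∈ S2, u x ≠ 0)

/-- the first buckling eigenvalue β₁(Ω) = inf { ∫(Δ̂u)²/∫|Du|² : u ∈ W₀^{2,2}(Ω), u ≠ const } -/
def buck1 (Ω : Set E3) : ℝ :=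
  sInf { r : ℝ | ∃ u : E3 → ℝ, admissibleW0 Ω u ∧
    r = (∫ x in Ω, (sLap u x)^2 ∂muS) / (∫ x in Ω, ‖sGrad u x‖^2 ∂muS) }

open Metric Set Filter Topology
open scoped Pointwise ENNReal NNReal

/-- Two finite measures on a compact metric space, each giving equal mass to balls of equal
radius, are proportional. -/
theorem exists_eq_smul_of_uniformly_distributed {X : Type*} [MetricSpace X] [CompactSpace X]
    [Nonempty X] [MeasurableSpace X] [BorelSpace X] (μ ν : Measure X) [IsFiniteMeasure μ]
    [IsFiniteMeasure ν] [ν.IsOpenPosMeasure]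
    (hμ : ∀ (r : ℝ) (x y : X), μ (ball x r) = μ (ball y r))
    (hν : ∀ (r : ℝ) (x y : X), ν (ball x r) = ν (ball y r)) :
    ∃ c : ℝ≥0, μ = c • ν := by
  obtain ⟨x₀⟩ := ‹Nonempty X›
  have hνpos : 0 < ν.real univ := by
    rw [measureReal_def]
    exact ENNReal.toReal_pos (isOpen_univ.measure_pos ν ⟨x₀, trivial⟩).ne' (measure_ne_top _ _)
  have key (f : C(X, ℝ)) (δ : ℝ) :
      ν.real (ball x₀ δ) * ∫ x, f x ∂μ = ∫ y, (∫ x in ball y δ, f x ∂μ) ∂ν := by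
    set F : X → X → ℝ := fun x y => {p : X × X | dist p.1 p.2 < δ}.indicator
      (fun p => f p.1) (x, y) with hF
    have hmeas : MeasurableSet {p : X × X | dist p.1 p.2 < δ} :=
      (isOpen_lt continuous_dist continuous_const).measurableSet
    have hint : Integrable (Function.uncurry F) (μ.prod ν) := by
      have : Integrable (fun p : X × X => f p.1) (μ.prod ν) := by
        have hc : Continuous fun p : X × X => f p.1 := by fun_prop
        exact hc.integrable_of_hasCompactSupport (HasCompactSupport.of_compactSpace _)
      exact this.indicator hmeas
    have h := integral_integral_swap hint
    have h1 (x : X) : ∫ y, F x y ∂ν = ν.real (ball x₀ δ) * f x := by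
      have : (fun y => F x y) = (ball x δ).indicator (fun _ => f x) := by
        ext y
        simp [hF, indicator, dist_comm]
      rw [this, integral_indicator measurableSet_ball, setIntegral_const, smul_eq_mul,
        measureReal_def, measureReal_def, hν δ x x₀]
    have h2 (y : X) : ∫ x, F x y ∂μ = ∫ x in ball y δ, f x ∂μ := by
      have : (fun x => F x y) = (ball y δ).indicator (fun x => f x) := by
        ext x
        simp [hF, indicator]
      rw [this, integral_indicator measurableSet_ball]
    simp_rw [h1, h2] at h
    rw [← h, integral_const_mul]
  have hmass (δ : ℝ) : ν.real (ball x₀ δ) * μ.real univ = μ.real (ball x₀ δ) * ν.real univ := by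
    have h := key 1 δ
    have h' (y : X) : μ.real (ball y δ) = μ.real (ball x₀ δ) := by
      rw [measureReal_def, measureReal_def, hμ δ y x₀]
    simp only [ContinuousMap.one_apply, integral_const, smul_eq_mul, mul_one,
      MeasurableSet.univ, measureReal_restrict_apply, univ_inter, h'] at h
    rw [h, mul_comm]
  have hcont (f : C(X, ℝ)) : ∫ x, f x ∂μ = μ.real univ / ν.real univ * ∫ x, f x ∂ν := by
    have hfi (m : Measure X) [IsFiniteMeasure m] : Integrable f m :=
      f.continuous.integrable_of_hasCompactSupport (HasCompactSupport.of_compactSpace _)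
    have hbound (ε : ℝ) (hε : 0 < ε) :
        |∫ x, f x ∂μ - μ.real univ / ν.real univ * ∫ x, f x ∂ν| ≤ ε * μ.real univ := by
      obtain ⟨δ, hδ, hfδ⟩ := Metric.uniformContinuous_iff.1
        (CompactSpace.uniformContinuous_of_continuous f.continuous) ε hε
      have hk : 0 < ν.real (ball x₀ δ) := by
        rw [measureReal_def]
        exact ENNReal.toReal_pos (isOpen_ball.measure_pos ν ⟨x₀, mem_ball_self hδ⟩).ne'
          (measure_ne_top _ _)
      set k := ν.real (ball x₀ δ)
      set h := μ.real (ball x₀ δ)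
      have hpt (y : X) : ‖(∫ x in ball y δ, f x ∂μ) - h * f y‖ ≤ ε * h := by
        have e : h * f y = ∫ x in ball y δ, f y ∂μ := by
          rw [setIntegral_const, smul_eq_mul, measureReal_def, hμ δ y x₀, ← measureReal_def]
        rw [e, ← integral_sub (hfi μ).integrableOn (integrable_const _)]
        refine (norm_setIntegral_le_of_norm_le_const (measure_lt_top _ _)
          (C := ε) fun x hx => ?_).trans ?_
        · rw [← dist_eq_norm]
          exact (hfδ hx).le
        · rw [measureReal_def, hμ δ y x₀, ← measureReal_def]
      have hF := key f δ
      have hyint : Integrable (fun y => ∫ x in ball y δ, f x ∂μ) ν := by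
        have hmeas : MeasurableSet {p : X × X | dist p.2 p.1 < δ} :=
          (isOpen_lt (by fun_prop) continuous_const).measurableSet
        have hc : Continuous fun p : X × X => f p.2 := by fun_prop
        have := ((hc.integrable_of_hasCompactSupport (μ := ν.prod μ)
          (HasCompactSupport.of_compactSpace _)).indicator hmeas).integral_prod_left
        refine this.congr (Eventually.of_forall fun y => ?_)
        dsimp only
        rw [← integral_indicator measurableSet_ball]
        rfl
      have hle : |k * ∫ x, f x ∂μ - h * ∫ x, f x ∂ν| ≤ ε * h * ν.real univ := by
        rw [hF, ← integral_const_mul, ← integral_sub hyint ((hfi ν).const_mul h),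
          ← Real.norm_eq_abs]
        refine (norm_integral_le_of_norm_le_const (C := ε * h)
          (Eventually.of_forall hpt))
      have hm : k * μ.real univ = h * ν.real univ := hmass δ
      have hh : h = k * (μ.real univ / ν.real univ) := by field_simp; linarith
      have e : k * ∫ x, f x ∂μ - h * ∫ x, f x ∂ν =
          k * (∫ x, f x ∂μ - μ.real univ / ν.real univ * ∫ x, f x ∂ν) := by rw [hh]; ring
      rw [e, abs_mul, abs_of_pos hk, mul_assoc, ← hm] at hle
      refine le_of_mul_le_mul_left (hle.trans_eq ?_) hk
      ring
    by_contra hne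
    have hpos := abs_pos.2 (sub_ne_zero.2 hne)
    rcases (measureReal_nonneg (μ := μ) (s := univ)).eq_or_lt with h0 | h0
    · have := hbound 1 one_pos
      rw [← h0] at this hpos
      linarith
    · have := hbound (|∫ x, f x ∂μ - μ.real univ / ν.real univ * ∫ x, f x ∂ν| /
        (2 * μ.real univ)) (by positivity)
      have e : |∫ x, f x ∂μ - μ.real univ / ν.real univ * ∫ x, f x ∂ν| /
        (2 * μ.real univ) * μ.real univ =
          |∫ x, f x ∂μ - μ.real univ / ν.real univ * ∫ x, f x ∂ν| / 2 := by field_simp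
      rw [e] at this
      linarith
  refine ⟨(μ.real univ / ν.real univ).toNNReal,
    ext_of_forall_integral_eq_of_IsFiniteMeasure fun f => ?_⟩
  rw [integral_smul_nnreal_measure, NNReal.smul_def, smul_eq_mul,
    Real.coe_toNNReal _ (by positivity)]
  exact hcont f.toContinuousMap

theorem exists_linearIsometryEquiv_apply_eq {x y : E3} (h : ‖x‖ = ‖y‖) :
    ∃ L : E3 ≃ₗᵢ[ℝ] E3, L x = y :=
  ⟨_, Submodule.reflection_sub h⟩

theorem LinearIsometryEquiv.image_ball_inter_sphere (L : E3 ≃ₗᵢ[ℝ] E3) (x : E3) (r : ℝ) :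
    L '' (ball x r ∩ sphere 0 1) = ball (L x) r ∩ sphere 0 1 := by
  rw [image_inter L.injective, L.image_ball, L.image_sphere, map_zero]

theorem coe_image_ball_sphere (x : sphere (0 : E3) 1) (r : ℝ) :
    ((↑) : sphere (0 : E3) 1 → E3) '' ball x r = ball (x : E3) r ∩ sphere 0 1 := by
  ext y
  constructor
  · rintro ⟨z, hz, rfl⟩
    exact ⟨hz, z.2⟩
  · rintro ⟨h1, h2⟩
    exact ⟨⟨y, h2⟩, h1, rfl⟩

theorem hausdorffMeasure_ball_sphere_eq (r : ℝ) (x y : sphere (0 : E3) 1) :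
    μH[2] (ball x r) = μH[2] (ball y r) := by
  obtain ⟨L, hL⟩ := exists_linearIsometryEquiv_apply_eq (x := (x : E3)) (y := y)
    (by simp)
  have e (z : sphere (0 : E3) 1) : μH[2] (ball z r) = μH[2] (ball (z : E3) r ∩ sphere 0 1) := by
    rw [← coe_image_ball_sphere, isometry_subtype_coe.hausdorffMeasure_image (Or.inl (by norm_num))]
  rw [e, e, ← hL, ← L.image_ball_inter_sphere,
    L.isometry.hausdorffMeasure_image (Or.inl (by norm_num))]

theorem toSphere_ball_eq (r : ℝ) (x y : sphere (0 : E3) 1) :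
    (volume : Measure E3).toSphere (ball x r) = (volume : Measure E3).toSphere (ball y r) := by
  obtain ⟨L, hL⟩ := exists_linearIsometryEquiv_apply_eq (x := (x : E3)) (y := y)
    (by simp)
  rw [Measure.toSphere_apply' _ measurableSet_ball, Measure.toSphere_apply' _ measurableSet_ball,
    coe_image_ball_sphere, coe_image_ball_sphere, ← hL, ← L.image_ball_inter_sphere]
  have h : Ioo (0 : ℝ) 1 • (L '' (ball (x : E3) r ∩ sphere 0 1)) =
      L '' (Ioo (0 : ℝ) 1 • (ball (x : E3) r ∩ sphere 0 1)) := by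
    ext z
    simp only [Set.mem_smul, mem_image]
    constructor
    · rintro ⟨t, ht, _, ⟨w, hw, rfl⟩, rfl⟩
      exact ⟨t • w, ⟨t, ht, w, hw, rfl⟩, by simp⟩
    · rintro ⟨_, ⟨t, ht, w, hw, rfl⟩, rfl⟩
      exact ⟨t, ht, L w, ⟨w, hw, rfl⟩, by simp⟩
  rw [h, L.image_eq_preimage_symm]
  congr 1
  exact (L.symm.measurePreserving.measure_preimage_equiv (f := L.symm.toMeasurableEquiv) _).symm

/-- Geographic coordinates on the sphere. -/
def sphereChart (p : ℝ × ℝ) : E3 := !₂[cos p.1 * cos p.2, cos p.1 * sin p.2, sin p.1]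

theorem contDiff_sphereChart : ContDiff ℝ 1 sphereChart := by
  rw [contDiff_piLp]
  intro i
  fin_cases i <;> simp [sphereChart] <;> fun_prop

theorem sphere_subset_image_sphereChart :
    sphere (0 : E3) 1 ⊆ sphereChart '' (closedBall 0 4) := by
  intro x hx
  have hx1 : x 0 ^ 2 + x 1 ^ 2 + x 2 ^ 2 = 1 := by
    have := EuclideanSpace.norm_sq_eq x
    rw [mem_sphere_zero_iff_norm.1 hx] at this
    simpa [Fin.sum_univ_three] using this.symm
  set z : ℂ := ⟨x 0, x 1⟩
  have hc : cos (arcsin (x 2)) = ‖z‖ := by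
    rw [cos_arcsin, Complex.norm_def, Complex.normSq_mk]
    congr 1
    linarith
  have hs : sin (arcsin (x 2)) = x 2 := sin_arcsin (by nlinarith) (by nlinarith)
  refine ⟨(arcsin (x 2), z.arg), ?_, ?_⟩
  · rw [mem_closedBall_zero_iff, Prod.norm_mk, max_le_iff, norm_eq_abs, norm_eq_abs]
    refine ⟨abs_le.2 ⟨?_, ?_⟩, (Complex.abs_arg_le_pi z).trans pi_le_four⟩
    · linarith [neg_pi_div_two_le_arcsin (x 2), pi_le_four]
    · linarith [arcsin_le_pi_div_two (x 2), pi_le_four]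
  · ext i
    fin_cases i
    · simp [sphereChart, hc, Complex.norm_mul_cos_arg, z]
    · simp [sphereChart, hc, Complex.norm_mul_sin_arg, z]
    · simp [sphereChart, hs]

theorem hausdorffMeasure_sphere_lt_top : μH[2] (sphere (0 : E3) 1) < ∞ := by
  obtain ⟨K, hK⟩ := contDiff_sphereChart.contDiffOn.exists_lipschitzOnWith one_ne_zero
    (convex_closedBall (0 : ℝ × ℝ) 4) (isCompact_closedBall 0 4)
  calc μH[2] (sphere (0 : E3) 1) ≤ μH[2] (sphereChart '' (closedBall 0 4)) :=
        measure_mono sphere_subset_image_sphereChart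
    _ ≤ (K : ℝ≥0∞) ^ (2 : ℝ) * μH[2] (closedBall (0 : ℝ × ℝ) 4) :=
        hK.hausdorffMeasure_image_le (by norm_num)
    _ < ∞ := by
        rw [hausdorffMeasure_prod_real]
        exact ENNReal.mul_lt_top (ENNReal.rpow_lt_top_of_nonneg (by norm_num) (by simp))
          (isCompact_closedBall _ _).measure_lt_top

theorem hausdorffMeasure_sphere_pos : 0 < μH[2] (sphere (0 : E3) 1) := by
  set P : E3 → ℝ × ℝ := fun x => (x 0, x 1)
  have hP : LipschitzWith 1 P := by
    refine LipschitzWith.of_dist_le_mul fun x y => ?_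
    simp only [P, NNReal.coe_one, one_mul, Prod.dist_eq, max_le_iff]
    constructor
    · simpa [dist_eq_norm] using PiLp.norm_apply_le (x - y) 0
    · simpa [dist_eq_norm] using PiLp.norm_apply_le (x - y) 1
  have hsub : ball (0 : ℝ × ℝ) (1 / 2) ⊆ P '' sphere (0 : E3) 1 := by
    rintro ⟨a, b⟩ hab
    rw [mem_ball_zero_iff, Prod.norm_mk, max_lt_iff, norm_eq_abs, norm_eq_abs, abs_lt, abs_lt]
      at hab
    obtain ⟨⟨h1, h2⟩, h3, h4⟩ := hab
    refine ⟨!₂[a, b, √(1 - a ^ 2 - b ^ 2)], ?_, by simp [P]⟩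
    rw [mem_sphere_zero_iff_norm, EuclideanSpace.norm_eq, sqrt_eq_one]
    simp only [Fin.sum_univ_three, norm_eq_abs, sq_abs]
    have : 0 ≤ 1 - a ^ 2 - b ^ 2 := by nlinarith
    simp [sq_sqrt this]
  have h1 := hP.hausdorffMeasure_image_le (d := 2) (by norm_num) (sphere (0 : E3) 1)
  rw [ENNReal.coe_one, ENNReal.one_rpow, one_mul] at h1
  refine lt_of_lt_of_le ?_ ((measure_mono hsub).trans h1)
  rw [hausdorffMeasure_prod_real]
  exact measure_ball_pos _ _ (by norm_num)

/-- The area measure of the sphere is a positive multiple of the one induced by Lebesgue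
measure. -/
theorem exists_muS_eq : ∃ c : ℝ≥0, 0 < c ∧
    muS.restrict S2 = (c • (volume : Measure E3).toSphere).map (↑) := by
  have huniv : (μH[2] : Measure (sphere (0 : E3) 1)) univ = μH[2] (sphere (0 : E3) 1) := by
    rw [← isometry_subtype_coe.hausdorffMeasure_image (Or.inl (by norm_num)), image_univ,
      Subtype.range_coe]
  have : IsFiniteMeasure (μH[2] : Measure (sphere (0 : E3) 1)) :=
    ⟨huniv ▸ hausdorffMeasure_sphere_lt_top⟩
  have : Nonempty (sphere (0 : E3) 1) := (NormedSpace.sphere_nonempty.2 zero_le_one).to_subtype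
  obtain ⟨c, hc⟩ := exists_eq_smul_of_uniformly_distributed
    (μH[2] : Measure (sphere (0 : E3) 1)) (volume : Measure E3).toSphere
    hausdorffMeasure_ball_sphere_eq toSphere_ball_eq
  refine ⟨c, pos_iff_ne_zero.2 ?_, ?_⟩
  · rintro rfl
    have := hausdorffMeasure_sphere_pos.ne'
    rw [← huniv, hc] at this
    simp at this
  · rw [← hc, isometry_subtype_coe.map_hausdorffMeasure (Or.inl (by norm_num)),
      Subtype.range_coe]
    rfl

/-- The `i`-th partial derivative. -/
def pd (i : Fin 3) (f : E3 → ℝ) (y : E3) : ℝ := fderiv ℝ f y (EuclideanSpace.single i 1)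

theorem lap3_eq_sum_pd (f : E3 → ℝ) (y : E3) : lap3 f y = ∑ i, pd i (pd i f) y := rfl

theorem isOpen_ne_zero : IsOpen {y : E3 | y ≠ 0} := isOpen_ne

theorem fderiv_apply_eq_sum_pd (f : E3 → ℝ) (y w : E3) : fderiv ℝ f y w = ∑ i, w i * pd i f y := by
  have h : w = ∑ i, w i • EuclideanSpace.single i (1 : ℝ) := by
    ext j
    fin_cases j <;> simp [Fin.sum_univ_three]
  conv_lhs => rw [h]
  simp [pd]

theorem norm_gradient_sq (f : E3 → ℝ) (y : E3) : ‖gradient f y‖ ^ 2 = ∑ i, pd i f y ^ 2 := by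
  rw [EuclideanSpace.norm_sq_eq]
  refine Finset.sum_congr rfl fun i _ => ?_
  have : pd i f y = gradient f y i := by
    rw [pd, ← InnerProductSpace.toDual_symm_apply (𝕜 := ℝ)]
    simp only [gradient, EuclideanSpace.inner_single_right]
    simp
  rw [this, norm_eq_abs, sq_abs]

section Smooth

variable {f : E3 → ℝ}

theorem ContDiffOn.pd (hf : ContDiffOn ℝ (⊤ : ℕ∞) f {y | y ≠ 0}) (i : Fin 3) :
    ContDiffOn ℝ (⊤ : ℕ∞) (pd i f) {y | y ≠ 0} :=
  (hf.fderiv_of_isOpen isOpen_ne_zero (by simp)).clm_apply contDiffOn_const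

theorem ContDiffOn.differentiableAt_of_ne_zero (hf : ContDiffOn ℝ (⊤ : ℕ∞) f {y | y ≠ 0}) {y : E3}
    (hy : y ≠ 0) : DifferentiableAt ℝ f y :=
  (hf.contDiffAt (isOpen_ne_zero.mem_nhds hy)).differentiableAt (by simp)

theorem pd_comm (hf : ContDiffOn ℝ (⊤ : ℕ∞) f {y | y ≠ 0}) (i j : Fin 3) {y : E3} (hy : y ≠ 0) :
    pd i (pd j f) y = pd j (pd i f) y := by
  have hc := hf.contDiffAt (isOpen_ne_zero.mem_nhds hy)
  have hd : DifferentiableAt ℝ (fderiv ℝ f) y :=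
    ((hf.fderiv_of_isOpen (m := 1) isOpen_ne_zero (by
      norm_cast)).contDiffAt (isOpen_ne_zero.mem_nhds hy)).differentiableAt (by simp)
  have h (a b : Fin 3) : pd a (pd b f) y =
      fderiv ℝ (fderiv ℝ f) y (EuclideanSpace.single a 1) (EuclideanSpace.single b 1) := by
    have e : pd b f = fun z => fderiv ℝ f z (EuclideanSpace.single b 1) := rfl
    rw [pd, e, fderiv_clm_apply hd (by fun_prop)]
    simp
  rw [h, h]
  exact (hc.isSymmSndFDerivAt (by simpa using WithTop.coe_le_coe.2 (le_top (a := (2 : ℕ∞))))) _ _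

theorem pd_congr_of_ne_zero {g : E3 → ℝ} (h : ∀ y ≠ 0, f y = g y) (i : Fin 3) {y : E3}
    (hy : y ≠ 0) : pd i f y = pd i g y := by
  rw [pd, pd, Filter.EventuallyEq.fderiv_eq]
  filter_upwards [isOpen_ne_zero.mem_nhds hy] with z hz using h z hz

end Smooth

/-- Positive homogeneity of degree `-k`. -/
def HomogeneousNeg (k : ℕ) (f : E3 → ℝ) : Prop :=
  ∀ t : ℝ, 0 < t → ∀ y, t ^ k * f (t • y) = f y

theorem HomogeneousNeg.pd {k : ℕ} {f : E3 → ℝ} (hf : HomogeneousNeg k f) (i : Fin 3) :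
    HomogeneousNeg (k + 1) (pd i f) := by
  intro t ht y
  have h : f = fun y => t ^ k • f (t • y) := funext fun y => (hf t ht y).symm
  conv_rhs => rw [h]
  have h1 : (fun y => t ^ k • f (t • y)) = t ^ k • fun y => f (t • y) := rfl
  rw [_root_.pd, _root_.pd, h1, fderiv_const_smul_field, Pi.smul_apply, fderiv_comp_smul]
  simp
  ring

/-- Euler's identity. -/
theorem HomogeneousNeg.sum_mul_pd {k : ℕ} {f : E3 → ℝ} (hf : HomogeneousNeg k f) {y : E3}
    (hd : DifferentiableAt ℝ f y) : ∑ i, y i * _root_.pd i f y = -(k * f y) := by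
  rw [← fderiv_apply_eq_sum_pd]
  have h1 : HasDerivAt (fun t : ℝ => t • y) y 1 := by
    simpa using (hasDerivAt_id (1 : ℝ)).smul_const y
  have h2 : HasDerivAt (fun t : ℝ => f (t • y)) (fderiv ℝ f y y) 1 := by
    have hd' : HasFDerivAt f (fderiv ℝ f y) ((1 : ℝ) • y) := by
      rw [one_smul]; exact hd.hasFDerivAt
    exact hd'.comp_hasDerivAt (1 : ℝ) h1
  have h3 := (hasDerivAt_pow k (1 : ℝ)).mul h2
  have h4 : HasDerivAt (fun t : ℝ => t ^ k * f (t • y)) 0 1 := by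
    refine (hasDerivAt_const (1 : ℝ) (f y)).congr_of_eventuallyEq ?_
    filter_upwards [lt_mem_nhds one_pos] with t ht using hf t ht y
  have h5 := h3.unique h4
  simp only [one_pow, mul_one, one_smul, one_mul] at h5
  linarith

theorem homogeneousNeg_hom0 (u : E3 → ℝ) : HomogeneousNeg 0 (hom0 u) := by
  intro t ht y
  rw [pow_zero, one_mul, hom0, hom0, norm_smul, norm_eq_abs, abs_of_pos ht, smul_smul]
  congr 2
  field_simp

section Bochner

variable {v : E3 → ℝ}

/-- The squared norm of the Euclidean Hessian. -/
def hessSq (v : E3 → ℝ) (y : E3) : ℝ := ∑ i, ∑ j, pd i (pd j v) y ^ 2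

/-- The squared norm of the Euclidean gradient. -/
def gradSq (v : E3 → ℝ) (y : E3) : ℝ := ∑ j, pd j v y ^ 2

/-- The field `|y|² (D²v ∇v - Δv ∇v) + |∇v|² y`; it is orthogonal to `y` when `v` is homogeneous
of degree zero. -/
def bochnerField (v : E3 → ℝ) (i : Fin 3) (y : E3) : ℝ :=
  ‖y‖ ^ 2 * (∑ j, pd i (pd j v) y * pd j v y - lap3 v y * pd i v y) + gradSq v y * y i

/-- The divergence of `bochnerField`. -/
def bochnerDiv (v : E3 → ℝ) (y : E3) : ℝ :=
  ‖y‖ ^ 2 * (hessSq v y - lap3 v y ^ 2) - gradSq v y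

theorem sum_mul_pd_pd (hv : ContDiffOn ℝ (⊤ : ℕ∞) v {y | y ≠ 0}) (hh : HomogeneousNeg 0 v) {y : E3}
    (hy : y ≠ 0) (j : Fin 3) : ∑ i, y i * pd i (pd j v) y = -pd j v y := by
  have := (hh.pd j).sum_mul_pd ((hv.pd j).differentiableAt_of_ne_zero hy)
  simpa using this

theorem sum_mul_bochnerField (hv : ContDiffOn ℝ (⊤ : ℕ∞) v {y | y ≠ 0}) (hh : HomogeneousNeg 0 v)
    {y : E3} (hy : y ≠ 0) : ∑ i, y i * bochnerField v i y = 0 := by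
  have e0 := hh.sum_mul_pd (hv.differentiableAt_of_ne_zero hy)
  have e1 := sum_mul_pd_pd hv hh hy
  have hn : ‖y‖ ^ 2 = ∑ i, y i ^ 2 := by simp [EuclideanSpace.norm_sq_eq]
  simp only [bochnerField, gradSq, hn, Fin.sum_univ_three] at e0 e1 ⊢
  linear_combination (y 0 ^ 2 + y 1 ^ 2 + y 2 ^ 2) * (pd 0 v y * e1 0 + pd 1 v y * e1 1 +
    pd 2 v y * e1 2 - lap3 v y * e0)

theorem contDiffOn_bochnerField (hv : ContDiffOn ℝ (⊤ : ℕ∞) v {y | y ≠ 0}) (i : Fin 3) :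
    ContDiffOn ℝ (⊤ : ℕ∞) (bochnerField v i) {y | y ≠ 0} := by
  have h1 (j : Fin 3) := hv.pd j
  have h2 (j k : Fin 3) := (hv.pd j).pd k
  have h3 : ContDiffOn ℝ (⊤ : ℕ∞) (lap3 v) {y | y ≠ 0} := ContDiffOn.sum fun j _ => h2 j j
  have h4 : ContDiffOn ℝ (⊤ : ℕ∞) (gradSq v) {y | y ≠ 0} :=
    ContDiffOn.sum fun j _ => (h1 j).pow 2
  have h5 : ContDiff ℝ (⊤ : ℕ∞) fun y : E3 => y i := by fun_prop
  exact ((contDiff_norm_sq ℝ).contDiffOn.mul ((ContDiffOn.sum fun j _ => (h2 j i).mul (h1 j)).sub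
    (h3.mul (h1 i)))).add (h4.mul h5.contDiffOn)

theorem pd_norm_sq (i : Fin 3) (y : E3) : pd i (fun y => ‖y‖ ^ 2) y = 2 * y i := by
  rw [pd, fderiv_norm_sq_apply]
  simp [EuclideanSpace.inner_single_right]

theorem sum_pd_bochnerField (hv : ContDiffOn ℝ (⊤ : ℕ∞) v {y | y ≠ 0}) (hh : HomogeneousNeg 0 v)
    {y : E3} (hy : y ≠ 0) : ∑ i, pd i (bochnerField v i) y = bochnerDiv v y := by
  have d1 (j : Fin 3) := ((hv.pd j).differentiableAt_of_ne_zero hy).hasFDerivAt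
  have d2 (i j : Fin 3) := (((hv.pd j).pd i).differentiableAt_of_ne_zero hy).hasFDerivAt
  have dN : HasFDerivAt (fun y : E3 => ‖y‖ ^ 2) (fderiv ℝ (fun y : E3 => ‖y‖ ^ 2) y) y :=
    ((contDiff_norm_sq ℝ).differentiable one_ne_zero y).hasFDerivAt
  have hpd (i : Fin 3) : pd i (bochnerField v i) y =
      2 * y i * (∑ j, pd i (pd j v) y * pd j v y - lap3 v y * pd i v y) +
      ‖y‖ ^ 2 * (∑ j, (pd i (pd i (pd j v)) y * pd j v y + pd i (pd j v) y ^ 2) -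
        ((∑ j, pd i (pd j (pd j v)) y) * pd i v y + lap3 v y * pd i (pd i v) y)) +
      ((∑ j, 2 * pd j v y * pd i (pd j v) y) * y i + gradSq v y) := by
    have dy : HasFDerivAt (fun y : E3 => y i) (EuclideanSpace.proj i : E3 →L[ℝ] ℝ) y :=
      (EuclideanSpace.proj i : E3 →L[ℝ] ℝ).hasFDerivAt
    have dl : HasFDerivAt (lap3 v) (∑ j, fderiv ℝ (pd j (pd j v)) y) y :=
      HasFDerivAt.fun_sum fun j _ => d2 j j
    have dg := HasFDerivAt.fun_sum (u := Finset.univ) fun (j : Fin 3) _ => (d1 j).pow 2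
    have ds := HasFDerivAt.fun_sum (u := Finset.univ) fun (j : Fin 3) _ => (d2 i j).mul (d1 j)
    have := ((dN.mul (ds.sub (dl.mul (d1 i)))).add (dg.mul dy)).fderiv
    have hN := pd_norm_sq i y
    unfold pd at hN
    have h2 := congrArg (fun L : E3 →L[ℝ] ℝ => L (EuclideanSpace.single i 1)) this
    refine h2.trans ?_
    simp [hN, gradSq, Fin.sum_univ_three, -fderiv_norm_sq_apply]
    simp only [← pd.eq_def]
    ring
  have e0 := hh.sum_mul_pd (hv.differentiableAt_of_ne_zero hy)
  have e1 := sum_mul_pd_pd hv hh hy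
  have hT (i j : Fin 3) : pd j (pd j (pd i v)) y = pd i (pd j (pd j v)) y := by
    rw [pd_congr_of_ne_zero (fun z hz => pd_comm hv j i hz) j hy, pd_comm (hv.pd j) j i hy]
  have hs (i j : Fin 3) := pd_comm hv i j hy
  simp only [hpd, bochnerDiv, hessSq, gradSq, lap3_eq_sum_pd, Fin.sum_univ_three] at e0 e1 ⊢
  linear_combination (4 * (pd 0 v y * e1 0 + pd 1 v y * e1 1 + pd 2 v y * e1 2)
    - 2 * (pd 0 (pd 0 v) y + pd 1 (pd 1 v) y + pd 2 (pd 2 v) y) * e0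
    + ‖y‖ ^ 2 * (pd 1 v y * hT 1 0 + pd 2 v y * hT 2 0 + pd 0 v y * hT 0 1 + pd 2 v y * hT 2 1
      + pd 0 v y * hT 0 2 + pd 1 v y * hT 1 2))

theorem hessSq_ge (hv : ContDiffOn ℝ (⊤ : ℕ∞) v {y | y ≠ 0}) (hh : HomogeneousNeg 0 v) {x : E3}
    (hx : ‖x‖ = 1) : 2 * gradSq v x + lap3 v x ^ 2 / 2 ≤ hessSq v x := by
  have hx0 : x ≠ 0 := by
    rintro rfl
    simp at hx
  have e0 := hh.sum_mul_pd (hv.differentiableAt_of_ne_zero hx0)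
  have e1 := sum_mul_pd_pd hv hh hx0
  have hs (i j : Fin 3) := pd_comm hv i j hx0
  have hn : ∑ i, x i ^ 2 = 1 := by
    rw [← one_pow 2, ← hx]
    simp [EuclideanSpace.norm_sq_eq]
  set K : Fin 3 → Fin 3 → ℝ := fun i j => pd i (pd j v) x + pd i v x * x j + x i * pd j v x -
    lap3 v x / 2 * ((if i = j then 1 else 0) - x i * x j) with hK
  have hpos : 0 ≤ ∑ i, ∑ j, K i j ^ 2 := by positivity
  suffices ∑ i, ∑ j, K i j ^ 2 = hessSq v x - 2 * gradSq v x - lap3 v x ^ 2 / 2 by linarith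
  have hL : lap3 v x = pd 0 (pd 0 v) x + pd 1 (pd 1 v) x + pd 2 (pd 2 v) x := by
    rw [lap3_eq_sum_pd, Fin.sum_univ_three]
  have a0 := e1 0
  have a1 := e1 1
  have a2 := e1 2
  have s1 := hs 1 0
  have s2 := hs 2 0
  have s3 := hs 2 1
  simp only [hK, hessSq, gradSq, Fin.sum_univ_three] at e0 a0 a1 a2 hn ⊢
  simp only [s1, s2, s3] at a0 a1 a2 ⊢
  generalize lap3 v x = L at *
  generalize pd 0 (pd 0 v) x = A at *
  generalize pd 0 (pd 1 v) x = B at *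
  generalize pd 0 (pd 2 v) x = C at *
  generalize pd 1 (pd 1 v) x = D at *
  generalize pd 1 (pd 2 v) x = F at *
  generalize pd 2 (pd 2 v) x = G at *
  generalize pd 0 v x = p at *
  generalize pd 1 v x = q at *
  generalize pd 2 v x = r at *
  generalize x 0 = a at *
  generalize x 1 = b at *
  generalize x 2 = c at *
  simp only [CharP.cast_eq_zero, zero_mul, neg_zero, Fin.reduceEq, if_true, if_false] at e0 ⊢
  linear_combination 2 * (p ^ 2 + q ^ 2 + r ^ 2) * hn + 2 * (a * p + b * q + c * r) * e0
    + L ^ 2 / 4 * (a ^ 2 + b ^ 2 + c ^ 2 - 1) * hn + 4 * (p * a0 + q * a1 + r * a2) + L * hL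
    + L * (a * a0 + b * a1 + c * a2) - L * (3 - 2 * (a ^ 2 + b ^ 2 + c ^ 2)) * e0

end Bochner

theorem integral_pd_eq_zero {f : E3 → ℝ} (hf : ContDiff ℝ 1 f) (hc : HasCompactSupport f)
    (i : Fin 3) : ∫ y, pd i f y = 0 := by
  have hint : Integrable (pd i f) :=
    ((hf.continuous_fderiv one_ne_zero).clm_apply continuous_const).integrable_of_hasCompactSupport
      (hc.fderiv_apply ℝ _)
  have h := integral_mul_fderiv_eq_neg_fderiv_mul_of_integrable (μ := (volume : Measure E3))
    (f := fun _ => (1 : ℝ)) (g := f) (v := EuclideanSpace.single i 1)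
    (by simp) (by simpa using! hint)
    (by simpa using hf.continuous.integrable_of_hasCompactSupport hc)
    (fun _ _ => by fun_prop) (fun _ _ => hf.differentiable one_ne_zero _)
  simpa [pd] using h

/-- A bump function on the half line. -/
def radialBump : ContDiffBump (2 : ℝ) := ⟨1 / 2, 1, by norm_num, by norm_num⟩

/-- A smooth radial cutoff supported in an annulus. -/
def radialCutoff (y : E3) : ℝ := radialBump (‖y‖ ^ 2)

theorem contDiff_radialCutoff : ContDiff ℝ 1 radialCutoff :=
  radialBump.contDiff.comp (contDiff_norm_sq ℝ)

theorem radialCutoff_eq_zero {y : E3} (hy : ‖y‖ < 1 ∨ 2 < ‖y‖) : radialCutoff y = 0 := by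
  refine radialBump.zero_of_le_dist ?_
  rw [show radialBump.rOut = 1 from rfl, dist_eq, le_abs]
  rcases hy with hy | hy
  · right
    nlinarith [norm_nonneg y]
  · left
    nlinarith

theorem hasCompactSupport_radialCutoff_mul (f : E3 → ℝ) :
    HasCompactSupport fun y => radialCutoff y * f y := by
  refine HasCompactSupport.intro (isCompact_closedBall 0 2) fun y hy => ?_
  rw [mem_closedBall_zero_iff, not_le] at hy
  simp [radialCutoff_eq_zero (Or.inr hy)]

theorem contDiff_radialCutoff_mul {f : E3 → ℝ} (hf : ContDiffOn ℝ (⊤ : ℕ∞) f {y | y ≠ 0}) :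
    ContDiff ℝ 1 fun y => radialCutoff y * f y := by
  rw [contDiff_iff_contDiffAt]
  intro y
  by_cases hy : y = 0
  · refine (contDiffAt_const (c := (0 : ℝ))).congr_of_eventuallyEq ?_
    filter_upwards [ball_mem_nhds y one_pos] with z hz
    rw [hy, mem_ball_zero_iff] at hz
    simp [radialCutoff_eq_zero (Or.inl hz)]
  · exact contDiff_radialCutoff.contDiffAt.mul
      ((hf.contDiffAt (isOpen_ne_zero.mem_nhds hy)).of_le (by simp))

theorem HomogeneousNeg.apply_eq {k : ℕ} {f : E3 → ℝ} (hf : HomogeneousNeg k f) {t : ℝ} (ht : 0 < t)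
    (y : E3) : f (t • y) = f y / t ^ k := by
  rw [← hf t ht y]
  field_simp

theorem integral_radialCutoff_mul {G : E3 → ℝ} (hG : HomogeneousNeg 2 G) :
    ∫ y, radialCutoff y * G y = (∫ x : sphere (0 : E3) 1, G x ∂(volume : Measure E3).toSphere) *
      ∫ r : Ioi (0 : ℝ), radialBump (r.1 ^ 2) / r.1 ^ 2 ∂.volumeIoiPow 2 := by
  have hdim : Module.finrank ℝ E3 - 1 = 2 := by simp
  calc ∫ y, radialCutoff y * G y
      = ∫ y : ({(0)}ᶜ : Set E3), radialCutoff y * G y ∂(volume.comap Subtype.val) := by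
        rw [integral_subtype_comap (measurableSet_singleton _).compl
          fun y => radialCutoff y * G y, restrict_compl_singleton]
    _ = ∫ p : sphere (0 : E3) 1 × Ioi (0 : ℝ), G (p.1 : E3) * (radialBump (p.2.1 ^ 2) / p.2.1 ^ 2)
          ∂(volume : Measure E3).toSphere.prod (.volumeIoiPow 2) := by
        have hmp := (volume : Measure E3).measurePreserving_homeomorphUnitSphereProd
        rw [hdim] at hmp
        rw [← hmp.integral_comp (Homeomorph.measurableEmbedding _)]
        refine integral_congr_ae (Eventually.of_forall fun y => ?_)
        have hy : 0 < ‖y.1‖ := norm_pos_iff.2 y.2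
        simp only [homeomorphUnitSphereProd_apply_snd_coe, homeomorphUnitSphereProd_apply_fst_coe]
        rw [hG.apply_eq (inv_pos.2 hy), radialCutoff]
        field_simp
    _ = _ := integral_prod_mul (fun x : sphere (0 : E3) 1 => G (x : E3))
        fun r : Ioi (0 : ℝ) => radialBump (r.1 ^ 2) / r.1 ^ 2

theorem radial_factor_ne_zero :
    ∫ r : Ioi (0 : ℝ), radialBump (r.1 ^ 2) / r.1 ^ 2 ∂.volumeIoiPow 2 ≠ 0 := by
  intro h
  have hG : HomogeneousNeg 2 fun y => (‖y‖ ^ 2)⁻¹ := by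
    intro t ht y
    simp only [norm_smul, norm_eq_abs, abs_of_pos ht]
    field_simp
  have hpol := integral_radialCutoff_mul hG
  rw [h, mul_zero] at hpol
  have hs : ContDiffOn ℝ (⊤ : ℕ∞) (fun y : E3 => (‖y‖ ^ 2)⁻¹) {y | y ≠ 0} :=
    (contDiff_norm_sq ℝ).contDiffOn.inv fun y hy => by simpa using hy
  have hc := (contDiff_radialCutoff_mul hs).continuous
  have hp := hc.integral_pos_of_hasCompactSupport_nonneg_nonzero
    (μ := (volume : Measure E3)) (x := EuclideanSpace.single 0 (√2))
    (hasCompactSupport_radialCutoff_mul _)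
    (fun y => mul_nonneg radialBump.nonneg (by positivity)) (by
      have : radialBump 2 = 1 := radialBump.one_of_mem_closedBall
        (mem_closedBall_self radialBump.rIn_pos.le)
      simp [radialCutoff, this])
  exact hp.ne' hpol

theorem homogeneousNeg_bochnerDiv {v : E3 → ℝ} (hh : HomogeneousNeg 0 v) :
    HomogeneousNeg 2 (bochnerDiv v) := by
  intro t ht y
  have h1 (j : Fin 3) := (hh.pd j).apply_eq ht y
  have h2 (i j : Fin 3) := ((hh.pd j).pd i).apply_eq ht y
  simp only [bochnerDiv, hessSq, gradSq, lap3_eq_sum_pd, Fin.sum_univ_three, h1, h2, norm_smul,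
    norm_eq_abs, abs_of_pos ht, zero_add, one_add_one_eq_two]
  field_simp

/-- The integrated Bochner formula on the sphere, in terms of homogeneous extensions. -/
theorem integral_bochnerDiv_eq_zero {v : E3 → ℝ} (hv : ContDiffOn ℝ (⊤ : ℕ∞) v {y | y ≠ 0})
    (hh : HomogeneousNeg 0 v) :
    ∫ x : sphere (0 : E3) 1, bochnerDiv v x ∂(volume : Measure E3).toSphere = 0 := by
  have hX (i : Fin 3) := contDiff_radialCutoff_mul (contDiffOn_bochnerField hv i)
  have hXc (i : Fin 3) := hasCompactSupport_radialCutoff_mul (bochnerField v i)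
  have hdiv (y : E3) : ∑ i, pd i (fun y => radialCutoff y * bochnerField v i y) y =
      radialCutoff y * bochnerDiv v y := by
    by_cases hy : y = 0
    · have h (i : Fin 3) : pd i (fun y => radialCutoff y * bochnerField v i y) y = 0 := by
        have : (fun y => radialCutoff y * bochnerField v i y) =ᶠ[𝓝 y] fun _ => 0 := by
          filter_upwards [ball_mem_nhds y one_pos] with z hz
          rw [hy, mem_ball_zero_iff] at hz
          simp [radialCutoff_eq_zero (Or.inl hz)]
        rw [pd, this.fderiv_eq]
        simp
      simp [h, radialCutoff_eq_zero (y := y) (Or.inl (by simp [hy]))]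
    · have dN : HasFDerivAt (fun y : E3 => ‖y‖ ^ 2) (fderiv ℝ (fun y : E3 => ‖y‖ ^ 2) y) y :=
        ((contDiff_norm_sq ℝ).differentiable one_ne_zero y).hasFDerivAt
      have db : HasDerivAt radialBump (deriv radialBump (‖y‖ ^ 2)) (‖y‖ ^ 2) :=
        (radialBump.contDiff (n := 1).differentiable one_ne_zero _).hasDerivAt
      have h (i : Fin 3) : pd i (fun y => radialCutoff y * bochnerField v i y) y =
          deriv radialBump (‖y‖ ^ 2) * 2 * (y i * bochnerField v i y) +
            radialCutoff y * pd i (bochnerField v i) y := by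
        have hd := ((contDiffOn_bochnerField hv i).differentiableAt_of_ne_zero hy).hasFDerivAt
        have := congrArg (fun L : E3 →L[ℝ] ℝ => L (EuclideanSpace.single i 1))
          ((db.comp_hasFDerivAt y dN).mul hd).fderiv
        refine this.trans ?_
        have hN := pd_norm_sq i y
        unfold pd at hN ⊢
        simp [hN, radialCutoff, -fderiv_norm_sq_apply]
        ring
      simp_rw [h]
      rw [Finset.sum_add_distrib, ← Finset.mul_sum, ← Finset.mul_sum,
        sum_mul_bochnerField hv hh hy, sum_pd_bochnerField hv hh hy, mul_zero, zero_add]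
  have hint : ∫ y, radialCutoff y * bochnerDiv v y = 0 := by
    simp_rw [← hdiv]
    rw [integral_finsetSum]
    · exact Finset.sum_eq_zero fun i _ => integral_pd_eq_zero (hX i) (hXc i) i
    · exact fun i _ => (((hX i).continuous_fderiv one_ne_zero).clm_apply
        continuous_const).integrable_of_hasCompactSupport ((hXc i).fderiv_apply ℝ _)
  rw [integral_radialCutoff_mul (homogeneousNeg_bochnerDiv hh)] at hint
  exact (mul_eq_zero.1 hint).resolve_right radial_factor_ne_zero

/-- The gradient of a function vanishes to first order at almost every of its zeros. -/
theorem ae_pd_eq_zero_of_eq_zero {f : E3 → ℝ} (hf : ContDiffOn ℝ (⊤ : ℕ∞) f {y | y ≠ 0})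
    (hm : Measurable f) (i : Fin 3) : ∀ᵐ y : E3, y ≠ 0 → f y = 0 → pd i f y = 0 := by
  set e : E3 := EuclideanSpace.single 0 1
  have he : e ≠ 0 := by simp [e]
  set s : Set E3 := {y | y ≠ 0} ∩ {y | f y = 0}
  have hs : MeasurableSet s := isOpen_ne_zero.measurableSet.inter (hm (measurableSet_singleton 0))
  have hlin : ApproximatesLinearOn (fun y => f y • e) (0 : E3 →L[ℝ] E3) s 0 := by
    intro x hx y hy
    simp [show f x = 0 from hx.2, show f y = 0 from hy.2]
  have := hlin.norm_fderiv_sub_le (volume : Measure E3) hs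
    (fun y => (fderiv ℝ f y).smulRight e) fun y hy =>
      ((hf.differentiableAt_of_ne_zero hy.1).hasFDerivAt.smul_const e).hasFDerivWithinAt
  rw [ae_restrict_iff' hs] at this
  filter_upwards [this] with y hy h0 h1
  have h2 := hy ⟨h0, h1⟩
  rw [sub_zero, nonpos_iff_eq_zero, nnnorm_eq_zero] at h2
  have h3 := congrArg (fun L : E3 →L[ℝ] E3 => L (EuclideanSpace.single i 1)) h2
  simpa [he] using! h3

theorem measurable_pd (i : Fin 3) (f : E3 → ℝ) : Measurable (pd i f) :=
  measurable_fderiv_apply_const ℝ f _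

theorem pd_eq_zero_of_gradSq_eq_zero {v : E3 → ℝ} {y : E3} (h : gradSq v y = 0) (i : Fin 3) :
    pd i v y = 0 := by
  rw [gradSq, Finset.sum_eq_zero_iff_of_nonneg fun _ _ => sq_nonneg _] at h
  exact pow_eq_zero_iff two_ne_zero |>.1 (h i (Finset.mem_univ i))

theorem ae_lap3_eq_zero_of_gradSq_eq_zero {v : E3 → ℝ}
    (hv : ContDiffOn ℝ (⊤ : ℕ∞) v {y | y ≠ 0}) (hh : HomogeneousNeg 0 v) :
    ∀ᵐ x : sphere (0 : E3) 1 ∂(volume : Measure E3).toSphere, gradSq v x = 0 → lap3 v x = 0 := by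
  set N : Set (sphere (0 : E3) 1) := {x | ¬(gradSq v x = 0 → lap3 v x = 0)}
  have hg : Measurable (gradSq v) :=
    Finset.measurable_fun_sum _ fun j _ => (measurable_pd j v).pow_const 2
  have hl : Measurable (lap3 v) := Finset.measurable_fun_sum _ fun j _ => measurable_pd j (pd j v)
  have hN : MeasurableSet N := by
    have : N = ((↑) : sphere (0 : E3) 1 → E3) ⁻¹' (gradSq v ⁻¹' {0} ∩ (lap3 v ⁻¹' {0})ᶜ) := by
      ext x
      simp [N]
    rw [this]
    exact measurable_subtype_coe
      ((hg (measurableSet_singleton _)).inter (hl (measurableSet_singleton _)).compl)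
  have hae : ∀ᵐ y : E3, ∀ j, y ≠ 0 → pd j v y = 0 → pd j (pd j v) y = 0 :=
    ae_all_iff.2 fun j => ae_pd_eq_zero_of_eq_zero (hv.pd j) (measurable_pd j v) j
  change (volume : Measure E3).toSphere N = 0
  rw [Measure.toSphere_apply' _ hN, mul_eq_zero]
  right
  refine measure_mono_null ?_ hae
  rintro _ ⟨t, ht, _, ⟨x, hx, rfl⟩, rfl⟩ hall
  refine hx fun hgx => ?_
  have hx0 : t • (x : E3) ≠ 0 := smul_ne_zero ht.1.ne' (ne_zero_of_mem_unit_sphere x)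
  rw [lap3_eq_sum_pd]
  refine Finset.sum_eq_zero fun j _ => ?_
  have hgj : pd j v x = 0 := pd_eq_zero_of_gradSq_eq_zero hgx j
  rw [← ((hh.pd j).pd j) t ht.1, hall j hx0 (by rw [(hh.pd j).apply_eq ht.1, hgj, zero_div]),
    mul_zero]

theorem exists_setIntegral_muS_eq : ∃ c : ℝ, 0 < c ∧ ∀ (Ω : Set E3) (g : E3 → ℝ), Ω ⊆ S2 →
    (∀ᵐ x : sphere (0 : E3) 1 ∂(volume : Measure E3).toSphere, (x : E3) ∉ Ω → g x = 0) →
    ∫ x in Ω, g x ∂muS = c * ∫ x : sphere (0 : E3) 1, g x ∂(volume : Measure E3).toSphere := by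
  obtain ⟨c, hc, h⟩ := exists_muS_eq
  have hemb : MeasurableEmbedding ((↑) : sphere (0 : E3) 1 → E3) :=
    .subtype_coe isClosed_sphere.measurableSet
  refine ⟨c, hc, fun Ω g hΩ hg => ?_⟩
  have hS : MeasurableSet S2 := isClosed_sphere.measurableSet
  have hae : ∀ᵐ x ∂muS, x ∈ S2 \ Ω → g x = 0 := by
    have h1 : ∀ᵐ x ∂muS.restrict S2, x ∉ Ω → g x = 0 := by
      rw [h, hemb.ae_map_iff]
      exact Measure.ae_smul_measure hg c
    rw [ae_restrict_iff' hS] at h1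
    filter_upwards [h1] with x hx hx'
    exact hx hx'.1 hx'.2
  rw [← setIntegral_eq_of_subset_of_ae_sdiff_eq_zero hS.nullMeasurableSet hΩ hae, h,
    hemb.integral_map, integral_smul_nnreal_measure, NNReal.smul_def, smul_eq_mul]

theorem continuous_restrict_sphere {f : E3 → ℝ} (hf : ContDiffOn ℝ (⊤ : ℕ∞) f {y | y ≠ 0}) :
    Continuous fun x : sphere (0 : E3) 1 => f x :=
  hf.continuousOn.comp_continuous continuous_subtype_val fun x => ne_zero_of_mem_unit_sphere x

theorem integrable_restrict_sphere {f : E3 → ℝ} (hf : ContDiffOn ℝ (⊤ : ℕ∞) f {y | y ≠ 0}) :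
    Integrable (fun x : sphere (0 : E3) 1 => f x) (volume : Measure E3).toSphere :=
  (continuous_restrict_sphere hf).integrable_of_hasCompactSupport (.of_compactSpace _)

section

variable {v : E3 → ℝ}

theorem contDiffOn_lap3 (hv : ContDiffOn ℝ (⊤ : ℕ∞) v {y | y ≠ 0}) :
    ContDiffOn ℝ (⊤ : ℕ∞) (lap3 v) {y | y ≠ 0} :=
  ContDiffOn.sum fun j _ => (hv.pd j).pd j

theorem contDiffOn_gradSq (hv : ContDiffOn ℝ (⊤ : ℕ∞) v {y | y ≠ 0}) :
    ContDiffOn ℝ (⊤ : ℕ∞) (gradSq v) {y | y ≠ 0} :=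
  ContDiffOn.sum fun j _ => (hv.pd j).pow 2

theorem contDiffOn_bochnerDiv (hv : ContDiffOn ℝ (⊤ : ℕ∞) v {y | y ≠ 0}) :
    ContDiffOn ℝ (⊤ : ℕ∞) (bochnerDiv v) {y | y ≠ 0} := by
  have h : ContDiffOn ℝ (⊤ : ℕ∞) (hessSq v) {y | y ≠ 0} :=
    ContDiffOn.sum fun i _ => ContDiffOn.sum fun j _ => ((hv.pd j).pd i).pow 2
  exact ((contDiff_norm_sq ℝ).contDiffOn.mul (h.sub ((contDiffOn_lap3 hv).pow 2))).sub
    (contDiffOn_gradSq hv)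

/-- On the closed sphere, `2 ∫ |Du|² ≤ ∫ (Δu)²`. -/
theorem two_mul_integral_gradSq_le (hv : ContDiffOn ℝ (⊤ : ℕ∞) v {y | y ≠ 0})
    (hh : HomogeneousNeg 0 v) :
    2 * ∫ x : sphere (0 : E3) 1, gradSq v x ∂(volume : Measure E3).toSphere ≤
      ∫ x : sphere (0 : E3) 1, lap3 v x ^ 2 ∂(volume : Measure E3).toSphere := by
  have hg := integrable_restrict_sphere (contDiffOn_gradSq hv)
  have hl := integrable_restrict_sphere ((contDiffOn_lap3 hv).pow 2)
  have h : ∫ x : sphere (0 : E3) 1, (gradSq v x - lap3 v x ^ 2 / 2)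
      ∂(volume : Measure E3).toSphere ≤ 0 := by
    rw [← integral_bochnerDiv_eq_zero hv hh]
    refine integral_mono (hg.sub (hl.div_const 2))
      (integrable_restrict_sphere (contDiffOn_bochnerDiv hv)) fun x => ?_
    have hx : ‖(x : E3)‖ = 1 := norm_eq_of_mem_sphere x
    have := hessSq_ge hv hh hx
    simp only [bochnerDiv, hx]
    linarith
  rw [integral_sub hg (hl.div_const 2), integral_div] at h
  linarith

theorem isPreconnected_ne_zero : IsPreconnected {y : E3 | y ≠ 0} := by
  have hr : 1 < Module.rank ℝ E3 := by
    rw [← Module.finrank_eq_rank, finrank_euclideanSpace_fin]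
    norm_num
  exact (isConnected_compl_singleton_of_one_lt_rank hr 0).isPreconnected

theorem gradSq_nonneg (v : E3 → ℝ) (y : E3) : 0 ≤ gradSq v y :=
  Finset.sum_nonneg fun _ _ => sq_nonneg _

theorem apply_eq_of_gradSq_eq_zero (hv : ContDiffOn ℝ (⊤ : ℕ∞) v {y | y ≠ 0})
    (hh : HomogeneousNeg 0 v) (h : ∀ y ∈ sphere (0 : E3) 1, gradSq v y = 0)
    {x p : E3} (hx : x ≠ 0) (hp : p ≠ 0) : v x = v p := by
  have hpd (i : Fin 3) (y : E3) (hy : y ≠ 0) : pd i v y = 0 := by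
    have hy' : 0 < ‖y‖ := norm_pos_iff.2 hy
    have hys : ‖y‖⁻¹ • y ∈ sphere (0 : E3) 1 := by simp [norm_smul, hy]
    rw [← (hh.pd i) _ (inv_pos.2 hy'), pd_eq_zero_of_gradSq_eq_zero (h _ hys) i, mul_zero]
  refine isOpen_ne_zero.is_const_of_fderiv_eq_zero (𝕜 := ℝ) isPreconnected_ne_zero
    (fun y hy => (hv.differentiableAt_of_ne_zero hy).differentiableWithinAt) (fun y hy => ?_) hx hp
  ext w
  rw [fderiv_apply_eq_sum_pd]
  simp [hpd _ y hy]

theorem integral_gradSq_pos (hv : ContDiffOn ℝ (⊤ : ℕ∞) v {y | y ≠ 0}) (hh : HomogeneousNeg 0 v)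
    {x p : E3} (hx : x ≠ 0) (hp : p ≠ 0) (hxp : v x ≠ v p) :
    0 < ∫ x : sphere (0 : E3) 1, gradSq v x ∂(volume : Measure E3).toSphere := by
  have hc := continuous_restrict_sphere (contDiffOn_gradSq hv)
  have hne : ∃ y : sphere (0 : E3) 1, gradSq v y ≠ 0 := by
    by_contra! h
    exact hxp (apply_eq_of_gradSq_eq_zero hv hh (fun y hy => h ⟨y, hy⟩) hx hp)
  obtain ⟨y, hy⟩ := hne
  exact hc.integral_pos_of_hasCompactSupport_nonneg_nonzero (.of_compactSpace _)
    (fun y => gradSq_nonneg v y) hy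

end

theorem exists_admissibleW0 {Ω V : Set E3} (hV : IsOpen V) (hΩ : Ω = V ∩ S2) (hne : Ω.Nonempty) :
    ∃ u, admissibleW0 Ω u := by
  obtain ⟨x₀, hx₀⟩ := hne
  rw [hΩ] at hx₀
  obtain ⟨ε, hε, hball⟩ := Metric.isOpen_iff.1 hV x₀ hx₀.1
  let b : ContDiffBump x₀ := ⟨ε / 4, ε / 2, by positivity, by linarith⟩
  have hn (x : E3) (hx : x ∈ S2) : (1 / ‖x‖) • x = x := by
    rw [mem_sphere_zero_iff_norm.1 hx]
    simp
  have hcont : ContDiffOn ℝ (⊤ : ℕ∞) (fun y : E3 => (1 / ‖y‖) • y) {y | y ≠ 0} := fun y hy =>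
    ((contDiffAt_const.div (contDiffAt_norm ℝ hy) (norm_ne_zero_iff.2 hy)).smul
      contDiffAt_id).contDiffWithinAt
  refine ⟨b, b.contDiff.comp_contDiffOn hcont, fun x hx hxΩ => ?_, x₀, hx₀.2, ?_⟩
  · have hxV : ε ≤ dist x x₀ := by
      by_contra! h
      exact hxΩ (hΩ ▸ ⟨hball h, hx⟩)
    refine ⟨b.zero_of_le_dist (by simp only [b]; linarith), ?_⟩
    have hx0 : x ≠ 0 := by
      rintro rfl
      simp [S2] at hx
    have hc : ContinuousAt (fun y : E3 => dist ((1 / ‖y‖) • y) x₀) x :=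
      ((hcont.continuousOn.continuousAt (isOpen_ne_zero.mem_nhds hx0))).dist continuousAt_const
    have hlt : ε / 2 < dist ((1 / ‖x‖) • x) x₀ := by
      rw [hn x hx]
      linarith
    have hev : hom0 b =ᶠ[𝓝 x] fun _ => 0 := by
      filter_upwards [hc.eventually (lt_mem_nhds hlt)] with y hy
      exact b.zero_of_le_dist hy.le
    rw [sGrad, gradient, hev.fderiv_eq]
    simp
  · have : b x₀ = 1 := b.one_of_mem_closedBall (mem_closedBall_self b.rIn_pos.le)
    simp [this]

theorem stmt7_first_buckling_eigenvalue_ge_two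
    (Ω : Set E3) (hΩ : Ω ⊆ S2) (hproper : Ω ≠ S2) (hne : Ω.Nonempty)
    (hΩopen : ∃ V : Set E3, IsOpen V ∧ Ω = V ∩ S2) (hΩmeas : MeasurableSet Ω) :
    2 ≤ buck1 Ω := by
  obtain ⟨V, hV, hΩV⟩ := hΩopen
  obtain ⟨c, hc, hint⟩ := exists_setIntegral_muS_eq
  obtain ⟨p, hpS, hpΩ⟩ : ∃ p ∈ S2, p ∉ Ω := by
    by_contra! h
    exact hproper (hΩ.antisymm h)
  refine le_csInf ?_ ?_
  · obtain ⟨u, hu⟩ := exists_admissibleW0 hV hΩV hne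
    exact ⟨_, u, hu, rfl⟩
  rintro r ⟨u, ⟨hsm, hvan, x, hxS, hux⟩, rfl⟩
  have hh := homogeneousNeg_hom0 u
  have hval (y : E3) (hy : y ∈ S2) : hom0 u y = u y := by
    rw [hom0, mem_sphere_zero_iff_norm.1 hy]
    simp
  have hgrad (y : E3) : ‖sGrad u y‖ ^ 2 = gradSq (hom0 u) y := norm_gradient_sq _ _
  have hvan' (y : sphere (0 : E3) 1) (hy : (y : E3) ∉ Ω) : gradSq (hom0 u) y = 0 := by
    rw [← hgrad, (hvan y y.2 hy).2]
    simp
  have hden : ∫ x in Ω, ‖sGrad u x‖ ^ 2 ∂muS =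
      c * ∫ x : sphere (0 : E3) 1, gradSq (hom0 u) x ∂(volume : Measure E3).toSphere := by
    simp_rw [hgrad]
    exact hint Ω _ hΩ (Eventually.of_forall hvan')
  have hnum : ∫ x in Ω, sLap u x ^ 2 ∂muS =
      c * ∫ x : sphere (0 : E3) 1, lap3 (hom0 u) x ^ 2 ∂(volume : Measure E3).toSphere := by
    refine hint Ω (fun x => sLap u x ^ 2) hΩ ?_
    filter_upwards [ae_lap3_eq_zero_of_gradSq_eq_zero hsm hh] with y hy hyΩ
    rw [sLap, hy (hvan' y hyΩ), zero_pow two_ne_zero]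
  have hpos : 0 < ∫ x : sphere (0 : E3) 1, gradSq (hom0 u) x ∂(volume : Measure E3).toSphere := by
    refine integral_gradSq_pos hsm hh (ne_zero_of_mem_unit_sphere ⟨x, hxS⟩)
      (ne_zero_of_mem_unit_sphere ⟨p, hpS⟩) ?_
    rwa [hval x hxS, hval p hpS, (hvan p hpS hpΩ).1]
  rw [hden, hnum, mul_div_mul_left _ _ hc.ne', le_div_iff₀ hpos]
  exact two_mul_integral_gradSq_le hsm hh
end
end

section
/- Let Ω ⊂⊂ S² and suppose q solves Δ̂(Δ̂q + 2q) = 0 on Ω. If f is a smooth function with f − q ∈ W₀^{2,2}(Ω), then (β₁(Ω) − 2)∫_Ω |Df − Dq|² dω + ∫_Ω Δ̂q · (Δ̂+2)q dω ≤ ∫_Ω Δ̂f · (Δ̂+2)f dω, where β₁(Ω) is the first buckling eigenvalue of Ω. -/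
/- STATEMENT 8: Dirichlet principle. If q solves Δ̂(Δ̂q + 2q) = 0 on Ω ⊂⊂ S² and f is
smooth with f − q ∈ W₀^{2,2}(Ω), then
(β₁(Ω) − 2)∫|Df−Dq|² + ∫ Δ̂q·(Δ̂+2)q ≤ ∫ Δ̂f·(Δ̂+2)f. -/
noncomputable section
open MeasureTheory Real
open scoped RealInnerProductSpace

theorem muS_S2_lt_top : muS S2 < ⊤ := by
  let p : ℝ × ℝ → E3 := fun a =>
    WithLp.toLp 2 ![sin a.1 * cos a.2, sin a.1 * sin a.2, cos a.1]
  have hp : ContDiff ℝ 1 p := by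
    rw [contDiff_euclidean]
    intro i
    fin_cases i <;> simp [p] <;> fun_prop
  let K : Set (ℝ × ℝ) := Set.Icc (-π) π ×ˢ Set.Icc (-π) π
  have hKc : IsCompact K := isCompact_Icc.prod isCompact_Icc
  obtain ⟨C, hC⟩ := hp.contDiffOn.exists_lipschitzOnWith (s := K) one_ne_zero
    ((convex_Icc _ _).prod (convex_Icc _ _)) hKc
  have hsub : S2 ⊆ p '' K := by
    intro x hx
    have hx1 : x 0 ^ 2 + x 1 ^ 2 + x 2 ^ 2 = 1 := by
      have := (EuclideanSpace.norm_sq_eq x).symm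
      simpa [Fin.sum_univ_three, mem_sphere_zero_iff_norm.1 hx] using this
    have h2 : -1 ≤ x 2 := by nlinarith [sq_nonneg (x 0), sq_nonneg (x 1)]
    have h2' : x 2 ≤ 1 := by nlinarith [sq_nonneg (x 0), sq_nonneg (x 1)]
    let z : ℂ := ⟨x 0, x 1⟩
    have hz : sin (arccos (x 2)) = ‖z‖ := by
      rw [sin_arccos, Complex.norm_eq_sqrt_sq_add_sq]
      congr 1
      simp only [z]
      linarith
    refine ⟨(arccos (x 2), z.arg), ⟨⟨?_, arccos_le_pi _⟩,
      ⟨(Complex.neg_pi_lt_arg z).le, Complex.arg_le_pi z⟩⟩, ?_⟩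
    · linarith [arccos_nonneg (x 2), pi_pos]
    · ext i
      fin_cases i
      · simp [p, hz, Complex.norm_mul_cos_arg, z]
      · simp [p, hz, Complex.norm_mul_sin_arg, z]
      · simp [p, cos_arccos h2 h2']
  calc muS S2 ≤ muS (p '' K) := measure_mono hsub
    _ ≤ _ := hC.hausdorffMeasure_image_le zero_le_two
    _ < ⊤ := by
      rw [hausdorffMeasure_prod_real]
      exact ENNReal.mul_lt_top (by simp) hKc.measure_lt_top

theorem countable_zeros_deriv_ne_zero {φ φ' : ℝ → ℝ} (h : ∀ t, HasDerivAt φ (φ' t) t) :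
    {t | φ t = 0 ∧ φ' t ≠ 0}.Countable := by
  refine (HereditarilyLindelofSpace.isLindelof _).countable ?_
  rw [discreteTopology_subtype_iff]
  rintro t ⟨-, ht⟩
  rw [← disjoint_iff, Filter.disjoint_principal_right]
  filter_upwards [(h t).eventually_ne ht (c := 0)] with s hs hs'
  exact hs hs'.1

/-- The derivative of `F` along the rotation field about the `i`-th coordinate axis. -/
def rotD (i : Fin 3) (F : E3 → ℝ) (y : E3) : ℝ :=
  fderiv ℝ F y (y (i + 1) • EuclideanSpace.single (i + 2) 1
    - y (i + 2) • EuclideanSpace.single (i + 1) 1)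

/-- The rotation by the angle `t` about the `i`-th coordinate axis. -/
def rot (i : Fin 3) (t : ℝ) (y : E3) : E3 :=
  y i • EuclideanSpace.single i 1
    + (cos t * y (i + 1) - sin t * y (i + 2)) • EuclideanSpace.single (i + 1) 1
    + (sin t * y (i + 1) + cos t * y (i + 2)) • EuclideanSpace.single (i + 2) 1

theorem norm_rot (i : Fin 3) (t : ℝ) (y : E3) : ‖rot i t y‖ = ‖y‖ := by
  rw [EuclideanSpace.norm_eq, EuclideanSpace.norm_eq]
  congr 1
  have h := sin_sq_add_cos_sq t
  fin_cases i <;> simp [rot, Fin.sum_univ_three] <;> grind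

/-- The rotation `rot i t` as a linear isometry equivalence. -/
def rotIsom (i : Fin 3) (t : ℝ) : E3 ≃ₗᵢ[ℝ] E3 :=
  LinearIsometry.toLinearIsometryEquiv
    { toFun := rot i t
      map_add' := fun x y => by simp only [rot, PiLp.add_apply]; module
      map_smul' := fun c x => by
        simp only [rot, PiLp.smul_apply, smul_eq_mul, RingHom.id_apply]
        module
      norm_map' := norm_rot i t } rfl

theorem measurePreserving_rot (i : Fin 3) (t : ℝ) :
    MeasurePreserving (rot i t) (muS.restrict S2) (muS.restrict S2) := by
  have h := ((rotIsom i t).toIsometryEquiv.measurePreserving_hausdorffMeasure 2).restrict_preimage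
    (s := S2) Metric.isClosed_sphere.measurableSet
  have h2 : (rotIsom i t).toIsometryEquiv ⁻¹' S2 = S2 := by
    ext x
    simp [S2]
  rw [h2] at h
  exact h

theorem continuous_rot (i : Fin 3) : Continuous fun p : E3 × ℝ => rot i p.2 p.1 := by
  unfold rot
  fun_prop

theorem hasDerivAt_rot (i : Fin 3) (y : E3) (t : ℝ) :
    HasDerivAt (fun t => rot i t y) (rot i t y (i + 1) • EuclideanSpace.single (i + 2) 1
      - rot i t y (i + 2) • EuclideanSpace.single (i + 1) 1) t := by
  have h : HasDerivAt (fun t => rot i t y) (0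
    + (-sin t * y (i + 1) - cos t * y (i + 2)) • EuclideanSpace.single (i + 1) (1 : ℝ)
    + (cos t * y (i + 1) + -sin t * y (i + 2)) • EuclideanSpace.single (i + 2) (1 : ℝ)) t := by
    unfold rot
    refine ((hasDerivAt_const _ _).add (HasDerivAt.smul_const ?_ _)).add
      (HasDerivAt.smul_const ?_ _)
    · exact ((hasDerivAt_cos t).mul_const _).sub ((hasDerivAt_sin t).mul_const _)
    · exact ((hasDerivAt_sin t).mul_const _).add ((hasDerivAt_cos t).mul_const _)
  convert h using 1
  ext j
  fin_cases i <;> fin_cases j <;> simp [rot] <;> ring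

theorem ne_zero_of_mem_S2 {x : E3} (hx : x ∈ S2) : x ≠ 0 :=
  ne_zero_of_mem_unit_sphere ⟨x, hx⟩

/-- Smoothness away from the origin. -/
def SmoothOffZero (F : E3 → ℝ) : Prop := ContDiffOn ℝ (⊤ : ℕ∞) F {y | y ≠ 0}

namespace SmoothOffZero

variable {F G : E3 → ℝ}

theorem contDiffAt (hF : SmoothOffZero F) {y : E3} (hy : y ≠ 0) : ContDiffAt ℝ (⊤ : ℕ∞) F y :=
  ContDiffOn.contDiffAt hF (isOpen_ne.mem_nhds hy)

theorem differentiableAt (hF : SmoothOffZero F) {y : E3} (hy : y ≠ 0) : DifferentiableAt ℝ F y :=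
  (hF.contDiffAt hy).differentiableAt (by simp)

theorem fderiv_apply (hF : SmoothOffZero F) {v : E3 → E3} (hv : ContDiff ℝ (⊤ : ℕ∞) v) :
    SmoothOffZero fun y => fderiv ℝ F y (v y) :=
  (ContDiffOn.fderiv_of_isOpen hF isOpen_ne (m := (⊤ : ℕ∞)) (by simp)).clm_apply hv.contDiffOn

theorem rotD (hF : SmoothOffZero F) (i : Fin 3) : SmoothOffZero (rotD i F) :=
  hF.fderiv_apply (by fun_prop)

theorem mul (hF : SmoothOffZero F) (hG : SmoothOffZero G) : SmoothOffZero fun y => F y * G y :=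
  ContDiffOn.mul hF hG

theorem sub (hF : SmoothOffZero F) (hG : SmoothOffZero G) : SmoothOffZero fun y => F y - G y :=
  ContDiffOn.sub hF hG

theorem add (hF : SmoothOffZero F) (hG : SmoothOffZero G) : SmoothOffZero fun y => F y + G y :=
  ContDiffOn.add hF hG

theorem const_mul (hF : SmoothOffZero F) (c : ℝ) : SmoothOffZero fun y => c * F y :=
  contDiffOn_const.mul hF

theorem sum {F : Fin 3 → E3 → ℝ} (hF : ∀ i, SmoothOffZero (F i)) :
    SmoothOffZero fun y => ∑ i, F i y :=
  ContDiffOn.sum fun i _ => hF i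

theorem lap3 (hF : SmoothOffZero F) : SmoothOffZero (lap3 F) :=
  sum fun _ => (hF.fderiv_apply contDiff_const).fderiv_apply contDiff_const

theorem exists_bound (hF : SmoothOffZero F) : ∃ C, ∀ x ∈ S2, ‖F x‖ ≤ C :=
  (isCompact_sphere (0 : E3) 1).exists_bound_of_continuousOn
    (hF.continuousOn.mono fun _ => ne_zero_of_mem_S2)

theorem measurable_indicator (hF : SmoothOffZero F) {Ω : Set E3} (hΩ : Ω ⊆ S2)
    (hΩmeas : MeasurableSet Ω) : Measurable (Ω.indicator F) := by
  classical
  have h := (hF.continuousOn.measurable_piecewise (g := 0) continuousOn_const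
    isOpen_ne.measurableSet).indicator hΩmeas
  convert h using 1
  ext x
  by_cases hx : x ∈ Ω
  · simp [hx, ne_zero_of_mem_S2 (hΩ hx)]
  · simp [hx]

theorem integrableOn (hF : SmoothOffZero F) {Ω : Set E3} (hΩ : Ω ⊆ S2)
    (hΩmeas : MeasurableSet Ω) : IntegrableOn F Ω muS := by
  obtain ⟨C, hC⟩ := hF.exists_bound
  refine IntegrableOn.of_bound ((measure_mono hΩ).trans_lt muS_S2_lt_top)
    ?_ C ((ae_restrict_mem hΩmeas).mono fun x hx => hC x (hΩ hx))
  exact (aestronglyMeasurable_indicator_iff hΩmeas).1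
    (hF.measurable_indicator hΩ hΩmeas).aestronglyMeasurable

end SmoothOffZero

theorem rot_mem_S2 {i : Fin 3} {t : ℝ} {x : E3} (hx : x ∈ S2) : rot i t x ∈ S2 := by
  rw [S2, mem_sphere_zero_iff_norm] at *
  rw [norm_rot, hx]

/-- Along every orbit of the rotation, `w` has zero derivative at almost every zero of `w`, so
restricting to `Ω` does not change the integral of the derivative. -/
theorem integral_indicator_rotD_rot {Ω : Set E3} {w : E3 → ℝ} (hw : SmoothOffZero w)
    (hw0 : ∀ x ∈ S2, x ∉ Ω → w x = 0) (i : Fin 3) {x : E3} (hx : x ∈ S2) :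
    ∫ t in (0)..(2 * π), Ω.indicator (rotD i w) (rot i t x) = 0 := by
  have hd : ∀ t, HasDerivAt (fun t => w (rot i t x)) (rotD i w (rot i t x)) t := fun t =>
    (hw.differentiableAt (ne_zero_of_mem_S2 (rot_mem_S2 hx))).hasFDerivAt.comp_hasDerivAt t
      (hasDerivAt_rot i x t)
  have hc : Continuous fun t => rotD i w (rot i t x) :=
    (hw.rotD i).continuousOn.comp_continuous
      ((continuous_rot i).comp (Continuous.prodMk_right x))
      fun t => ne_zero_of_mem_S2 (rot_mem_S2 hx)
  rw [intervalIntegral.integral_congr_ae (g := fun t => rotD i w (rot i t x)),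
    intervalIntegral.integral_eq_sub_of_hasDerivAt (fun t _ => hd t) (hc.intervalIntegrable _ _)]
  · simp [rot]
  · filter_upwards [(countable_zeros_deriv_ne_zero hd).ae_notMem volume] with t ht _
    by_cases h : rot i t x ∈ Ω
    · simp [h]
    · have h0 := hw0 _ (rot_mem_S2 hx) h
      simp only [h0, true_and, not_not] at ht
      simp [h, ht]

theorem setIntegral_rotD_eq_zero {Ω : Set E3} (hΩ : Ω ⊆ S2) (hΩmeas : MeasurableSet Ω)
    {w : E3 → ℝ} (hw : SmoothOffZero w) (hw0 : ∀ x ∈ S2, x ∉ Ω → w x = 0) (i : Fin 3) :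
    ∫ x in Ω, rotD i w x ∂muS = 0 := by
  let G := Ω.indicator (rotD i w)
  have hG : Measurable G := (hw.rotD i).measurable_indicator hΩ hΩmeas
  obtain ⟨C, hC⟩ := (hw.rotD i).exists_bound
  have hfin : IsFiniteMeasure (muS.restrict S2) := ⟨by simpa using muS_S2_lt_top⟩
  have hGC : ∀ x, ‖G x‖ ≤ |C| := fun x => by
    by_cases hx : x ∈ Ω
    · simpa [G, hx] using (hC x (hΩ hx)).trans (le_abs_self C)
    · simp [G, hx]
  have hI : Integrable (Function.uncurry fun (x : E3) (t : ℝ) => G (rot i t x))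
      ((muS.restrict S2).prod (volume.restrict (Set.Ioc 0 (2 * π)))) :=
    Integrable.of_bound (hG.comp (continuous_rot i).measurable).aestronglyMeasurable |C|
      (Filter.Eventually.of_forall fun _ => hGC _)
  have hS2 : MeasurableSet S2 := Metric.isClosed_sphere.measurableSet
  have hswap := integral_integral_swap hI
  have hleft : ∫ x in S2, (∫ t in Set.Ioc 0 (2 * π), G (rot i t x)) ∂muS = 0 :=
    setIntegral_eq_zero_of_forall_eq_zero fun x hx => by
      rw [← intervalIntegral.integral_of_le (by positivity)]
      exact integral_indicator_rotD_rot hw hw0 i hx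
  have hinner : ∀ t, ∫ x in S2, G (rot i t x) ∂muS = ∫ x in Ω, rotD i w x ∂muS := fun t => by
    rw [(measurePreserving_rot i t).integral_comp
      (rotIsom i t).toHomeomorph.measurableEmbedding, integral_indicator hΩmeas,
      Measure.restrict_restrict hΩmeas, Set.inter_eq_self_of_subset_left hΩ]
  rw [hleft] at hswap
  simp only [hinner, integral_const, smul_eq_mul] at hswap
  simpa [pi_ne_zero, pi_pos.le] using hswap

theorem rotD_mul {F G : E3 → ℝ} (hF : SmoothOffZero F) (hG : SmoothOffZero G) (i : Fin 3)
    {y : E3} (hy : y ≠ 0) :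
    rotD i (fun y => F y * G y) y = F y * rotD i G y + rotD i F y * G y := by
  simp only [rotD]
  rw [fderiv_fun_mul (hF.differentiableAt hy) (hG.differentiableAt hy)]
  simp only [add_apply, smul_apply, smul_eq_mul]
  ring

theorem hom0_smul (u : E3 → ℝ) {c : ℝ} (hc : 0 < c) (y : E3) : hom0 u (c • y) = hom0 u y := by
  simp only [hom0, norm_smul, norm_of_nonneg hc.le, smul_smul]
  congr 2
  field_simp

theorem hom0_of_mem_S2 (u : E3 → ℝ) {x : E3} (hx : x ∈ S2) : hom0 u x = u x := by
  rw [S2, mem_sphere_zero_iff_norm] at hx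
  simp [hom0, hx]

theorem fderiv_hom0_self {u : E3 → ℝ} (hu : SmoothOffZero (hom0 u)) {y : E3} (hy : y ≠ 0) :
    fderiv ℝ (hom0 u) y y = 0 := by
  have h1 : HasDerivAt (fun t : ℝ => t • y) y 1 := by
    simpa using (hasDerivAt_id (1 : ℝ)).smul_const y
  have h2 : HasFDerivAt (hom0 u) (fderiv ℝ (hom0 u) y) ((1 : ℝ) • y) := by
    simpa using (hu.differentiableAt hy).hasFDerivAt
  have h3 : HasDerivAt (fun t : ℝ => hom0 u (t • y)) 0 1 :=
    (hasDerivAt_const 1 (hom0 u y)).congr_of_eventuallyEq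
      ((eventually_gt_nhds one_pos).mono fun c hc => hom0_smul u hc y)
  exact HasDerivAt.unique (h2.comp_hasDerivAt (f := fun t : ℝ => t • y) 1 h1) h3

theorem sum_smul_single (x : E3) :
    x = x 0 • EuclideanSpace.single 0 1 + x 1 • EuclideanSpace.single 1 1
      + x 2 • EuclideanSpace.single 2 (1 : ℝ) := by
  ext j
  fin_cases j <;> simp

theorem sum_sq_of_mem_S2 {x : E3} (hx : x ∈ S2) : x 0 ^ 2 + x 1 ^ 2 + x 2 ^ 2 = 1 := by
  have := (EuclideanSpace.norm_sq_eq x).symm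
  simpa [Fin.sum_univ_three, mem_sphere_zero_iff_norm.1 hx] using this

theorem fderiv_fderiv_apply {F : E3 → ℝ} (hF : SmoothOffZero F) {x : E3} (hx : x ≠ 0)
    (L : E3 →L[ℝ] E3) (c w : E3) :
    fderiv ℝ (fun y => fderiv ℝ F y (L y + c)) x w
      = fderiv ℝ (fderiv ℝ F) x w (L x + c) + fderiv ℝ F x (L w) := by
  have hD : DifferentiableAt ℝ (fderiv ℝ F) x :=
    ((hF.contDiffAt hx).fderiv_right (m := 1) (by norm_cast)).differentiableAt one_ne_zero
  rw [(hD.hasFDerivAt.clm_apply (L.hasFDerivAt.add_const c)).fderiv]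
  simp [add_comm]

/-- The spherical Laplacian is the sum of the squares of the three rotation fields. -/
theorem lap3_hom0 {u : E3 → ℝ} (hu : SmoothOffZero (hom0 u)) {x : E3} (hx : x ∈ S2) :
    lap3 (hom0 u) x = ∑ i, rotD i (rotD i (hom0 u)) x := by
  have hx0 := ne_zero_of_mem_S2 hx
  set F := hom0 u
  set e : Fin 3 → E3 := fun i => EuclideanSpace.single i 1 with he
  let J (i : Fin 3) : E3 →L[ℝ] E3 :=
    (EuclideanSpace.proj (i + 1)).smulRight (e (i + 2))
      - (EuclideanSpace.proj (i + 2)).smulRight (e (i + 1))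
  have hlap : lap3 F x = ∑ i, fderiv ℝ (fderiv ℝ F) x (e i) (e i) :=
    Finset.sum_congr rfl fun i _ => by
      simpa using fderiv_fderiv_apply hu hx0 0 (e i) (e i)
  have hrot (i : Fin 3) : rotD i (rotD i F) x
      = fderiv ℝ (fderiv ℝ F) x (J i x) (J i x) + fderiv ℝ F x (J i (J i x)) := by
    have h := fderiv_fderiv_apply hu hx0 (J i) 0 (J i x)
    simp only [add_zero] at h
    exact h
  have hD := fderiv_hom0_self hu hx0
  have hH : fderiv ℝ (fderiv ℝ F) x x x + fderiv ℝ F x x = 0 := by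
    have h := fderiv_fderiv_apply hu hx0 (ContinuousLinearMap.id ℝ E3) 0 x
    simp only [ContinuousLinearMap.id_apply, add_zero] at h
    rw [← h, Filter.EventuallyEq.fderiv_eq (f := fun _ => (0 : ℝ))
      (Filter.mem_of_superset (isOpen_ne.mem_nhds hx0) fun y hy => fderiv_hom0_self hu hy)]
    simp
  have hn := sum_sq_of_mem_S2 hx
  have hxe : x = x 0 • e 0 + x 1 • e 1 + x 2 • e 2 := sum_smul_single x
  rw [hlap]
  simp only [hrot]
  generalize fderiv ℝ (fderiv ℝ F) x = H at *
  generalize fderiv ℝ F x = D at *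
  have hJ (i : Fin 3) (y : E3) : J i y = y (i + 1) • e (i + 2) - y (i + 2) • e (i + 1) := rfl
  rw [hxe] at hD hH
  simp only [map_add, map_smul, add_apply, smul_apply,
    smul_eq_mul] at hD hH
  simp only [hJ, Fin.sum_univ_three]
  simp [he] at hn hD hH ⊢
  linear_combination (-(H (EuclideanSpace.single 0 1) (EuclideanSpace.single 0 1)
    + H (EuclideanSpace.single 1 1) (EuclideanSpace.single 1 1)
    + H (EuclideanSpace.single 2 1) (EuclideanSpace.single 2 1))) * hn + hH + hD

theorem norm_sGrad_sq {u : E3 → ℝ} (hu : SmoothOffZero (hom0 u)) {x : E3} (hx : x ∈ S2) :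
    ‖sGrad u x‖ ^ 2 = ∑ i, rotD i (hom0 u) x * rotD i (hom0 u) x := by
  have hcoord (i : Fin 3) : sGrad u x i = fderiv ℝ (hom0 u) x (EuclideanSpace.single i 1) := by
    rw [← inner_gradient_left, EuclideanSpace.inner_single_right, sGrad]
    simp
  have hD := fderiv_hom0_self hu (ne_zero_of_mem_S2 hx)
  have hn := sum_sq_of_mem_S2 hx
  rw [EuclideanSpace.norm_sq_eq]
  simp only [hcoord, rotD, Fin.sum_univ_three]
  generalize fderiv ℝ (hom0 u) x = D at *
  rw [sum_smul_single x] at hD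
  simp at hD ⊢
  linear_combination (-(D (EuclideanSpace.single 0 1) ^ 2 + D (EuclideanSpace.single 1 1) ^ 2
    + D (EuclideanSpace.single 2 1) ^ 2)) * hn
    + (x 0 * D (EuclideanSpace.single 0 1) + x 1 * D (EuclideanSpace.single 1 1)
      + x 2 * D (EuclideanSpace.single 2 1)) * hD

theorem setIntegral_mul_rotD {Ω : Set E3} (hΩ : Ω ⊆ S2) (hΩmeas : MeasurableSet Ω)
    {F G : E3 → ℝ} (hF : SmoothOffZero F) (hG : SmoothOffZero G)
    (hFG : ∀ x ∈ S2, x ∉ Ω → F x * G x = 0) (i : Fin 3) :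
    ∫ x in Ω, F x * rotD i G x ∂muS = -∫ x in Ω, rotD i F x * G x ∂muS := by
  have h := setIntegral_rotD_eq_zero hΩ hΩmeas (hF.mul hG) hFG i
  rw [setIntegral_congr_fun hΩmeas fun x hx => rotD_mul hF hG i (ne_zero_of_mem_S2 (hΩ hx)),
    integral_add ((hF.mul (hG.rotD i)).integrableOn hΩ hΩmeas)
      (((hF.rotD i).mul hG).integrableOn hΩ hΩmeas)] at h
  linarith

theorem setIntegral_mul_sum_rotD {Ω : Set E3} (hΩ : Ω ⊆ S2) (hΩmeas : MeasurableSet Ω)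
    {F G : E3 → ℝ} (hF : SmoothOffZero F) (hG : SmoothOffZero G)
    (hFG : ∀ x ∈ S2, x ∉ Ω → ∀ i, F x * rotD i G x = 0) :
    ∫ x in Ω, F x * ∑ i, rotD i (rotD i G) x ∂muS
      = -∫ x in Ω, ∑ i, rotD i F x * rotD i G x ∂muS := by
  simp only [Finset.mul_sum]
  rw [integral_finsetSum _ fun i _ =>
      (hF.mul ((hG.rotD i).rotD i)).integrableOn hΩ hΩmeas,
    integral_finsetSum _ fun i _ =>
      ((hF.rotD i).mul (hG.rotD i)).integrableOn hΩ hΩmeas, ← Finset.sum_neg_distrib]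
  exact Finset.sum_congr rfl fun i _ =>
    setIntegral_mul_rotD hΩ hΩmeas hF (hG.rotD i) (fun x hx hxΩ => hFG x hx hxΩ i) i

theorem rotD_eq_zero_of_sGrad_eq_zero {u : E3 → ℝ} {x : E3} (h : sGrad u x = 0) (i : Fin 3) :
    rotD i (hom0 u) x = 0 := by
  rw [rotD, ← inner_gradient_left]
  change ⟪sGrad u x, _⟫ = 0
  rw [h, inner_zero_left]

theorem smoothS2.hom0_sLap {u : E3 → ℝ} (hu : smoothS2 u) : SmoothOffZero (hom0 (sLap u)) := by
  have hL : SmoothOffZero (sLap u) := SmoothOffZero.lap3 hu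
  refine ContDiffOn.comp (t := {y | y ≠ 0}) hL (fun y hy => ContDiffAt.contDiffWithinAt ?_) ?_
  · have hy' : y ≠ 0 := hy
    exact (contDiffAt_const.div (contDiffAt_norm ℝ hy') (norm_ne_zero_iff.2 hy')).smul
      contDiffAt_id
  · intro y hy
    simpa using hy

theorem smoothS2.sub {f g : E3 → ℝ} (hf : smoothS2 f) (hg : smoothS2 g) :
    smoothS2 fun y => f y - g y :=
  SmoothOffZero.sub hf hg

/-- Green's identity for the spherical Laplacian, in terms of rotation derivatives. -/
theorem setIntegral_mul_sLap {Ω : Set E3} (hΩ : Ω ⊆ S2) (hΩmeas : MeasurableSet Ω)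
    {g u : E3 → ℝ} (hg : smoothS2 g) (hu : smoothS2 u)
    (h0 : ∀ x ∈ S2, x ∉ Ω → g x = 0 ∨ sGrad u x = 0) :
    ∫ x in Ω, g x * sLap u x ∂muS
      = -∫ x in Ω, ∑ i, rotD i (hom0 g) x * rotD i (hom0 u) x ∂muS := by
  rw [← setIntegral_mul_sum_rotD hΩ hΩmeas hg hu]
  · exact setIntegral_congr_fun hΩmeas fun x hx => by
      rw [hom0_of_mem_S2 g (hΩ hx), ← lap3_hom0 hu (hΩ hx), sLap]
  · intro x hx hxΩ i
    rcases h0 x hx hxΩ with h | h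
    · rw [hom0_of_mem_S2 g hx, h, zero_mul]
    · rw [rotD_eq_zero_of_sGrad_eq_zero h, mul_zero]

theorem setIntegral_mul_sLap_comm {Ω : Set E3} (hΩ : Ω ⊆ S2) (hΩmeas : MeasurableSet Ω)
    {g u : E3 → ℝ} (hg : smoothS2 g) (hu : smoothS2 u)
    (h0 : ∀ x ∈ S2, x ∉ Ω → u x = 0 ∧ sGrad u x = 0) :
    ∫ x in Ω, g x * sLap u x ∂muS = ∫ x in Ω, u x * sLap g x ∂muS := by
  rw [setIntegral_mul_sLap hΩ hΩmeas hg hu fun x hx h => Or.inr (h0 x hx h).2,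
    setIntegral_mul_sLap hΩ hΩmeas hu hg fun x hx h => Or.inl (h0 x hx h).1]
  simp only [mul_comm]

theorem setIntegral_mul_sLap_self {Ω : Set E3} (hΩ : Ω ⊆ S2) (hΩmeas : MeasurableSet Ω)
    {u : E3 → ℝ} (hu : smoothS2 u) (h0 : ∀ x ∈ S2, x ∉ Ω → u x = 0 ∧ sGrad u x = 0) :
    ∫ x in Ω, u x * sLap u x ∂muS = -∫ x in Ω, ‖sGrad u x‖ ^ 2 ∂muS := by
  rw [setIntegral_mul_sLap hΩ hΩmeas hu hu fun x hx h => Or.inl (h0 x hx h).1,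
    setIntegral_congr_fun hΩmeas fun x hx => norm_sGrad_sq hu (hΩ hx)]

theorem sGrad_sub {f g : E3 → ℝ} (hf : smoothS2 f) (hg : smoothS2 g) {x : E3} (hx : x ∈ S2) :
    sGrad (fun y => f y - g y) x = sGrad f x - sGrad g x := by
  have h := fderiv_sub (SmoothOffZero.differentiableAt hf (ne_zero_of_mem_S2 hx))
    (SmoothOffZero.differentiableAt hg (ne_zero_of_mem_S2 hx))
  change (InnerProductSpace.toDual ℝ E3).symm (fderiv ℝ (hom0 f - hom0 g) x) = _
  rw [h, map_sub]
  rfl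

theorem sLap_sub {f g : E3 → ℝ} (hf : smoothS2 f) (hg : smoothS2 g) {x : E3} (hx : x ∈ S2) :
    sLap (fun y => f y - g y) x = sLap f x - sLap g x := by
  have hx0 := ne_zero_of_mem_S2 hx
  have hd : ∀ y ≠ 0, fderiv ℝ (hom0 fun y => f y - g y) y
      = fderiv ℝ (hom0 f) y - fderiv ℝ (hom0 g) y := fun y hy =>
    fderiv_sub (SmoothOffZero.differentiableAt hf hy) (SmoothOffZero.differentiableAt hg hy)
  simp only [sLap, lap3]
  rw [← Finset.sum_sub_distrib]
  refine Finset.sum_congr rfl fun i _ => ?_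
  set e : E3 := EuclideanSpace.single i 1
  have hev : (fun y => fderiv ℝ (hom0 fun y => f y - g y) y e) =ᶠ[nhds x]
      fun y => fderiv ℝ (hom0 f) y e - fderiv ℝ (hom0 g) y e :=
    Filter.mem_of_superset (isOpen_ne.mem_nhds hx0) fun y hy => by simp [hd y hy]
  rw [hev.fderiv_eq, fderiv_fun_sub
    ((SmoothOffZero.fderiv_apply hf contDiff_const).differentiableAt hx0)
    ((SmoothOffZero.fderiv_apply hg contDiff_const).differentiableAt hx0)]
  rfl

/-- The buckling inequality. -/
theorem buck1_mul_le {Ω : Set E3} {u : E3 → ℝ} (hΩ : Ω ⊆ S2) (hΩmeas : MeasurableSet Ω)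
    (hu : smoothS2 u) (h0 : ∀ x ∈ S2, x ∉ Ω → u x = 0 ∧ sGrad u x = 0) :
    buck1 Ω * ∫ x in Ω, ‖sGrad u x‖ ^ 2 ∂muS ≤ ∫ x in Ω, sLap u x ^ 2 ∂muS := by
  have hA : 0 ≤ ∫ x in Ω, sLap u x ^ 2 ∂muS := integral_nonneg fun _ => sq_nonneg _
  have hB : 0 ≤ ∫ x in Ω, ‖sGrad u x‖ ^ 2 ∂muS := integral_nonneg fun _ => sq_nonneg _
  rcases hB.eq_or_lt with hB0 | hB0
  · rwa [← hB0, mul_zero]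
  rw [← le_div_iff₀ hB0]
  refine csInf_le ⟨0, ?_⟩ ⟨u, ⟨hu, h0, ?_⟩, rfl⟩
  · rintro r ⟨v, -, rfl⟩
    exact div_nonneg (integral_nonneg fun _ => sq_nonneg _) (integral_nonneg fun _ => sq_nonneg _)
  · by_contra! h
    have h1 := setIntegral_mul_sLap_self hΩ hΩmeas hu h0
    rw [setIntegral_eq_zero_of_forall_eq_zero fun x hx => by rw [h x (hΩ hx), zero_mul]] at h1
    linarith

theorem stmt8_dirichlet_principle
    (Ω : Set E3) (hΩ : Ω ⊆ S2) (hne : Ω.Nonempty) (hproper : Ω ≠ S2)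
    (hΩopen : ∃ V : Set E3, IsOpen V ∧ Ω = V ∩ S2) (hΩmeas : MeasurableSet Ω)
    (q f : E3 → ℝ) (hq : smoothS2 q) (hf : smoothS2 f)
    -- q solves Δ̂(Δ̂q + 2q) = 0 on Ω :
    (hEL : ∀ x ∈ Ω, sLap (fun y => sLap q y + 2 * q y) x = 0)
    -- f − q ∈ W₀^{2,2}(Ω): f and q agree to first order off Ω :
    (hbc : ∀ x ∈ S2, x ∉ Ω → f x = q x ∧ sGrad f x = sGrad q x) :
    (buck1 Ω - 2) * ∫ x in Ω, ‖sGrad f x - sGrad q x‖^2 ∂muS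
      + ∫ x in Ω, sLap q x * (sLap q x + 2 * q x) ∂muS
      ≤ ∫ x in Ω, sLap f x * (sLap f x + 2 * f x) ∂muS := by
  set u : E3 → ℝ := fun y => f y - q y with hu_def
  set p : E3 → ℝ := fun y => sLap q y + 2 * q y with hp_def
  have hu : smoothS2 u := hf.sub hq
  have hp : smoothS2 p := hq.hom0_sLap.add (SmoothOffZero.const_mul hq 2)
  have h0 : ∀ x ∈ S2, x ∉ Ω → u x = 0 ∧ sGrad u x = 0 := fun x hx hxΩ => by
    rw [hu_def, sGrad_sub hf hq hx, sub_eq_zero, sub_eq_zero]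
    exact hbc x hx hxΩ
  have hpu : ∫ x in Ω, p x * sLap u x ∂muS = 0 := by
    rw [setIntegral_mul_sLap_comm hΩ hΩmeas hp hu h0]
    exact setIntegral_eq_zero_of_forall_eq_zero fun x hx => by rw [hEL x hx, mul_zero]
  have hqu := setIntegral_mul_sLap_comm hΩ hΩmeas hq hu h0
  have huu := setIntegral_mul_sLap_self hΩ hΩmeas hu h0
  have hbuck := buck1_mul_le hΩ hΩmeas hu h0
  have hgrad : ∫ x in Ω, ‖sGrad f x - sGrad q x‖ ^ 2 ∂muS = ∫ x in Ω, ‖sGrad u x‖ ^ 2 ∂muS :=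
    setIntegral_congr_fun hΩmeas fun x hx => by simp only [hu_def, sGrad_sub hf hq (hΩ hx)]
  have hI {F G : E3 → ℝ} (hF : smoothS2 F) (hG : SmoothOffZero G) :
      IntegrableOn (fun x => F x * G x) Ω muS :=
    ((SmoothOffZero.mul hF hG).integrableOn hΩ hΩmeas).congr_fun
      (fun x hx => by simp only [hom0_of_mem_S2 F (hΩ hx)]) hΩmeas
  have hLu : SmoothOffZero (sLap u) := SmoothOffZero.lap3 hu
  have hLq : SmoothOffZero (sLap q) := SmoothOffZero.lap3 hq
  have hLu2 : IntegrableOn (fun x => sLap u x ^ 2) Ω muS := by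
    simpa only [sq] using (hLu.mul hLu).integrableOn hΩ hΩmeas
  have hexp : ∫ x in Ω, sLap f x * (sLap f x + 2 * f x) ∂muS
      = ∫ x in Ω, ((((p x * sLap q x + sLap u x ^ 2) + 2 * (u x * sLap u x))
        + 2 * (p x * sLap u x)) + 2 * (u x * sLap q x)) - 2 * (q x * sLap u x) ∂muS :=
    setIntegral_congr_fun hΩmeas fun x hx => by
      have hfx : sLap f x = sLap q x + sLap u x := by
        rw [hu_def, sLap_sub hf hq (hΩ hx)]
        ring
      simp only [hfx, hp_def, hu_def]
      ring
  have i1 := (hI hp hLq).add hLu2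
  have i2 := i1.add ((hI hu hLu).const_mul 2)
  have i3 := i2.add ((hI hp hLu).const_mul 2)
  have i4 := i3.add ((hI hu hLq).const_mul 2)
  simp only [Pi.add_def] at i1 i2 i3 i4
  have hpq : ∫ x in Ω, sLap q x * (sLap q x + 2 * q x) ∂muS = ∫ x in Ω, p x * sLap q x ∂muS :=
    integral_congr_ae (Filter.Eventually.of_forall fun x => mul_comm _ _)
  rw [hgrad, hexp, integral_sub i4 ((hI hq hLu).const_mul 2),
    integral_add i3 ((hI hu hLq).const_mul 2), integral_add i2 ((hI hp hLu).const_mul 2),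
    integral_add i1 ((hI hu hLu).const_mul 2), integral_add (hI hp hLq) hLu2, hpq]
  simp only [integral_const_mul]
  rw [hpu, hqu, huu]
  linarith
end
end
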